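/- arXiv:2312.13709 — 2 statements merged into one kernel-verified Lean document; each statement's English description precedes it below -/
import Mathlib

section
/- Let E and F be sets of locally finite perimeter in ℝ^d, and for ρ > 0 set G_ρ := (E ∩ B_ρ) ∪ (F \ B_ρ), where B_ρ is the open ball of radius ρ centered at the origin. Then for all 0 < r < R one has ∫_r^R P(G_ρ, ∂B_ρ) dρ = ∫_r^R [ P(G_ρ, B_R) − P(E, B_ρ) − P(F, B_R \ B_ρ) ] dρ = |(E △ F) ∩ (B_R \ B_r)|. Consequently, the set of ρ ∈ (r,R) for which P(G_ρ, ∂B_ρ) ≤ |(E △ F) ∩ (B_R \ B_r)| / (R − r) has positive Lebesgue measure. -/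
open MeasureTheory Metric Set Filter Bornology
open scoped ENNReal symmDiff Topology

noncomputable section

/-- Euclidean space `ℝ^d`. -/
abbrev Rd (d : ℕ) : Type := EuclideanSpace ℝ (Fin d)

/-- Divergence of a vector field on `ℝ^d`. -/
def vdiv {d : ℕ} (φ : Rd d → Rd d) (x : Rd d) : ℝ :=
  ∑ i : Fin d, fderiv ℝ φ x (EuclideanSpace.single i (1 : ℝ)) i

/-- Relative perimeter of a set `E` in an open set `U`:
the supremum of `∫_E div φ` over `C¹` vector fields `φ` compactly supported in `U`
with `‖φ‖ ≤ 1`. -/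
def perimOpen {d : ℕ} (E U : Set (Rd d)) : ℝ≥0∞ :=
  ⨆ (φ : Rd d → Rd d) (_ : ContDiff ℝ 1 φ) (_ : HasCompactSupport φ)
      (_ : tsupport φ ⊆ U) (_ : ∀ x, ‖φ x‖ ≤ 1),
    ENNReal.ofReal (∫ x in E, vdiv φ x)

/-- Relative perimeter of `E` in an arbitrary set `A`, extended (by outer regularity)
from the values on open sets; this is the Borel measure `|D1_E|` evaluated at `A`. -/
def perim {d : ℕ} (E A : Set (Rd d)) : ℝ≥0∞ :=
  ⨅ (U : Set (Rd d)) (_ : IsOpen U) (_ : A ⊆ U), perimOpen E U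

/-- Perimeter of a partition: half of the sum of the relative perimeters of the regions. -/
def partPerim {d N : ℕ} (E : Fin N → Set (Rd d)) (A : Set (Rd d)) : ℝ≥0∞ :=
  (∑ k, perim (E k) A) / 2

/-- An `N`-partition of `Ω`: measurable regions, pairwise disjoint in `Ω` up to null sets,
covering `Ω` up to a null set. Regions of measure zero are allowed (improper partitions). -/
def IsPartition {d N : ℕ} (Ω : Set (Rd d)) (E : Fin N → Set (Rd d)) : Prop :=
  (∀ k, MeasurableSet (E k)) ∧
  (∀ k j, k ≠ j → volume (E k ∩ E j ∩ Ω) = 0) ∧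
  volume (Ω \ ⋃ k, E k) = 0

/-- A locally isoperimetric `N`-partition of `Ω`. -/
def LocallyIsoperimetric {d N : ℕ} (Ω : Set (Rd d)) (E : Fin N → Set (Rd d)) : Prop :=
  IsPartition Ω E ∧
  ∀ B : Set (Rd d), IsCompact B → B ⊆ Ω →
    ∀ F : Fin N → Set (Rd d), IsPartition Ω F →
      (∀ k, volume ((E k ∆ F k) \ B) = 0) →
      (∀ k, volume (F k) = volume (E k)) →
      partPerim E B ≤ partPerim F B

/-- A set of locally finite perimeter (Caccioppoli set). -/
def HasLocallyFinitePerimeter {d : ℕ} (E : Set (Rd d)) : Prop :=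
  ∀ U : Set (Rd d), IsOpen U → IsBounded U → perim E U < ⊤

structure IsTest {d : ℕ} (φ : Rd d → Rd d) (U : Set (Rd d)) : Prop where
  cd : ContDiff ℝ 1 φ
  cs : HasCompactSupport φ
  ts : tsupport φ ⊆ U
  le : ∀ x, ‖φ x‖ ≤ 1

theorem isTest_zero {d : ℕ} (U : Set (Rd d)) : IsTest (fun _ : Rd d => (0 : Rd d)) U := by
  refine ⟨contDiff_const, HasCompactSupport.zero, ?_, by simp⟩
  have : tsupport (fun _ : Rd d => (0 : Rd d)) = ∅ := by
    rw [tsupport_eq_empty_iff]; rfl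
  rw [this]; exact empty_subset _

theorem perimOpen_eq {d : ℕ} (E U : Set (Rd d)) :
    perimOpen E U = ⨆ φ : {φ : Rd d → Rd d // IsTest φ U},
      ENNReal.ofReal (∫ x in E, vdiv φ.1 x) := by
  apply le_antisymm
  · unfold perimOpen
    refine iSup_le fun φ => iSup_le fun h1 => iSup_le fun h2 => iSup_le fun h3 => iSup_le fun h4 => ?_
    exact le_iSup (fun φ : {φ : Rd d → Rd d // IsTest φ U} =>
      ENNReal.ofReal (∫ x in E, vdiv φ.1 x)) ⟨φ, h1, h2, h3, h4⟩
  · refine iSup_le fun ⟨φ, h⟩ => ?_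
    unfold perimOpen
    exact le_iSup_of_le φ (le_iSup_of_le h.cd (le_iSup_of_le h.cs (le_iSup_of_le h.ts
      (le_iSup_of_le h.le le_rfl))))

theorem le_perimOpen {d : ℕ} {E U : Set (Rd d)} {φ : Rd d → Rd d} (h : IsTest φ U) :
    ENNReal.ofReal (∫ x in E, vdiv φ x) ≤ perimOpen E U := by
  rw [perimOpen_eq]
  exact le_iSup (fun φ : {φ : Rd d → Rd d // IsTest φ U} =>
      ENNReal.ofReal (∫ x in E, vdiv φ.1 x)) ⟨φ, h⟩

theorem perimOpen_le {d : ℕ} {E U : Set (Rd d)} {c : ℝ≥0∞}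
    (h : ∀ φ : Rd d → Rd d, IsTest φ U → ENNReal.ofReal (∫ x in E, vdiv φ x) ≤ c) :
    perimOpen E U ≤ c := by
  rw [perimOpen_eq]
  exact iSup_le fun φ => h φ.1 φ.2

theorem IsTest.mono {d : ℕ} {U V : Set (Rd d)} {φ : Rd d → Rd d} (h : IsTest φ U) (hUV : U ⊆ V) :
    IsTest φ V := ⟨h.cd, h.cs, h.ts.trans hUV, h.le⟩

theorem perimOpen_mono {d : ℕ} {E U V : Set (Rd d)} (hUV : U ⊆ V) :
    perimOpen E U ≤ perimOpen E V :=
  perimOpen_le fun _ h => le_perimOpen (h.mono hUV)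

theorem perim_le {d : ℕ} {E A U : Set (Rd d)} (hU : IsOpen U) (h : A ⊆ U) :
    perim E A ≤ perimOpen E U := iInf_le_of_le U (iInf_le_of_le hU (iInf_le_of_le h le_rfl))

theorem le_perim {d : ℕ} {E A : Set (Rd d)} {c : ℝ≥0∞}
    (h : ∀ U, IsOpen U → A ⊆ U → c ≤ perimOpen E U) : c ≤ perim E A :=
  le_iInf fun U => le_iInf fun h1 => le_iInf fun h2 => h U h1 h2

theorem perim_open {d : ℕ} {E U : Set (Rd d)} (hU : IsOpen U) :
    perim E U = perimOpen E U :=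
  le_antisymm (perim_le hU le_rfl) (le_perim fun _ _ h => perimOpen_mono h)

theorem vdiv_eq_zero {d : ℕ} {φ : Rd d → Rd d} {x : Rd d} (hx : x ∉ tsupport φ) :
    vdiv φ x = 0 := by
  have : fderiv ℝ φ x = 0 := by
    by_contra h
    exact hx (support_fderiv_subset ℝ h)
  simp [vdiv, this]

theorem vdiv_continuous {d : ℕ} {φ : Rd d → Rd d} (h : ContDiff ℝ 1 φ) :
    Continuous (vdiv φ) := by
  unfold vdiv
  refine continuous_finsetSum _ fun i _ => ?_
  have h1 : Continuous (fun x => fderiv ℝ φ x (EuclideanSpace.single i (1 : ℝ))) :=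
    (h.continuous_fderiv (by norm_num)).clm_apply continuous_const
  fun_prop

theorem vdiv_hcs {d : ℕ} {φ : Rd d → Rd d} (h : HasCompactSupport φ) :
    HasCompactSupport (vdiv φ) :=
  h.mono' (fun x hx => by
    by_contra hc
    exact hx (vdiv_eq_zero hc))

theorem vdiv_integrable {d : ℕ} {φ : Rd d → Rd d} (h : ContDiff ℝ 1 φ)
    (h2 : HasCompactSupport φ) : Integrable (vdiv φ) :=
  (vdiv_continuous h).integrable_of_hasCompactSupport (vdiv_hcs h2)

theorem vdiv_add {d : ℕ} {φ ψ : Rd d → Rd d} (h : ContDiff ℝ 1 φ) (h' : ContDiff ℝ 1 ψ) :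
    vdiv (φ + ψ) = vdiv φ + vdiv ψ := by
  funext x
  simp only [vdiv, Pi.add_apply]
  rw [fderiv_add (h.differentiable (by norm_num) x) (h'.differentiable (by norm_num) x)]
  simp [Finset.sum_add_distrib]

theorem vdiv_neg {d : ℕ} {φ : Rd d → Rd d} (x : Rd d) :
    vdiv (fun y => - φ y) x = - vdiv φ x := by
  simp only [vdiv]
  rw [fderiv_fun_neg]
  simp

theorem vdiv_smul {d : ℕ} {η : Rd d → ℝ} {φ : Rd d → Rd d} (hη : ContDiff ℝ 1 η)
    (h : ContDiff ℝ 1 φ) (x : Rd d) :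
    vdiv (fun y => η y • φ y) x = η x * vdiv φ x + fderiv ℝ η x (φ x) := by
  simp only [vdiv]
  rw [fderiv_fun_smul (hη.differentiable (by norm_num) x) (h.differentiable (by norm_num) x)]
  have : φ x = ∑ i, (φ x i) • EuclideanSpace.single i (1 : ℝ) := by
    ext j
    simp [Finset.sum_apply, Pi.single_apply]
  conv_rhs => rw [this]
  simp only [map_sum, map_smul]
  rw [Finset.mul_sum, ← Finset.sum_add_distrib]
  refine Finset.sum_congr rfl fun i _ => ?_
  simp [mul_comm]

theorem IsTest.neg {d : ℕ} {U : Set (Rd d)} {φ : Rd d → Rd d} (h : IsTest φ U) :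
    IsTest (fun x => - φ x) U := by
  have ht : tsupport (fun x => - φ x) = tsupport φ := by
    unfold tsupport; congr 1; ext x; simp
  refine ⟨h.cd.neg, ?_, ?_, ?_⟩
  · unfold HasCompactSupport; rw [ht]; exact h.cs
  · rw [ht]; exact h.ts
  · intro x; rw [norm_neg]; exact h.le x

theorem IsTest.int_le {d : ℕ} {E U : Set (Rd d)} {φ : Rd d → Rd d} (h : IsTest φ U)
    (hfin : perimOpen E U < ⊤) : ∫ x in E, vdiv φ x ≤ (perimOpen E U).toReal :=
  (ENNReal.ofReal_le_iff_le_toReal hfin.ne).1 (le_perimOpen h)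

theorem IsTest.le_int {d : ℕ} {E U : Set (Rd d)} {φ : Rd d → Rd d} (h : IsTest φ U)
    (hfin : perimOpen E U < ⊤) : -(perimOpen E U).toReal ≤ ∫ x in E, vdiv φ x := by
  have := h.neg.int_le hfin
  simp only [vdiv_neg] at this
  rw [integral_neg] at this
  linarith

theorem perimOpen_congr {d : ℕ} {E E' U : Set (Rd d)} (hE : MeasurableSet E)
    (hE' : MeasurableSet E') (h : ∀ x ∈ U, x ∈ E ↔ x ∈ E') :
    perimOpen E U = perimOpen E' U := by
  rw [perimOpen_eq, perimOpen_eq]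
  congr 1
  funext φ
  congr 1
  rw [← integral_indicator hE, ← integral_indicator hE']
  congr 1
  funext x
  by_cases hx : x ∈ U
  · by_cases h1 : x ∈ E
    · rw [indicator_of_mem h1, indicator_of_mem ((h x hx).1 h1)]
    · rw [indicator_of_notMem h1, indicator_of_notMem (fun h2 => h1 ((h x hx).2 h2))]
  · have : vdiv φ.1 x = 0 := vdiv_eq_zero fun hc => hx (φ.2.ts hc)
    simp [indicator, this]

theorem perimOpen_add_le {d : ℕ} {E U V W : Set (Rd d)} (hUV : Disjoint U V)
    (hU : U ⊆ W) (hV : V ⊆ W) :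
    perimOpen E U + perimOpen E V ≤ perimOpen E W := by
  rw [perimOpen_eq E U, perimOpen_eq E V]
  have : Nonempty {φ : Rd d → Rd d // IsTest φ U} := ⟨⟨_, isTest_zero U⟩⟩
  have : Nonempty {φ : Rd d → Rd d // IsTest φ V} := ⟨⟨_, isTest_zero V⟩⟩
  refine ENNReal.iSup_add_iSup_le fun φ ψ => ?_
  obtain ⟨φ, h⟩ := φ
  obtain ⟨ψ, h'⟩ := ψ
  simp only
  rcases le_total (∫ x in E, vdiv φ x) 0 with h0 | h0
  · rw [ENNReal.ofReal_of_nonpos h0, zero_add]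
    exact le_perimOpen (h'.mono hV)
  rcases le_total (∫ x in E, vdiv ψ x) 0 with h1 | h1
  · rw [ENNReal.ofReal_of_nonpos h1, add_zero]
    exact le_perimOpen (h.mono hU)
  rw [← ENNReal.ofReal_add h0 h1, ← integral_add (vdiv_integrable h.cd h.cs).integrableOn
    (vdiv_integrable h'.cd h'.cs).integrableOn]
  have ht : IsTest (φ + ψ) W := by
    refine ⟨h.cd.add h'.cd, h.cs.add h'.cs, ?_, ?_⟩
    · exact (tsupport_add φ ψ).trans (union_subset (h.ts.trans hU) (h'.ts.trans hV))
    · intro x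
      by_cases hx : x ∈ U
      · have : ψ x = 0 := image_eq_zero_of_notMem_tsupport
          fun hc => (disjoint_left.1 hUV hx) (h'.ts hc)
        simpa [this] using h.le x
      · have : φ x = 0 := image_eq_zero_of_notMem_tsupport fun hc => hx (h.ts hc)
        simpa [this] using h'.le x
  have := le_perimOpen (E := E) ht
  rw [vdiv_add h.cd h'.cd] at this
  exact this

theorem radial_contDiff {d : ℕ} {f : ℝ → ℝ} (hf : ContDiff ℝ 1 f) {c δ : ℝ} (hδ : 0 < δ)
    (h : ∀ s, s < δ → f s = c) : ContDiff ℝ 1 (fun x : Rd d => f ‖x‖) := by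
  rw [contDiff_iff_contDiffAt]
  intro x
  by_cases hx : x = 0
  · subst hx
    refine (contDiffAt_const (c := c)).congr_of_eventuallyEq ?_
    filter_upwards [Metric.ball_mem_nhds (0 : Rd d) hδ] with y hy
    exact h _ (by simpa using hy)
  · exact hf.contDiffAt.comp x (contDiffAt_norm ℝ hx)

theorem radial_fderiv {d : ℕ} {f : ℝ → ℝ} (hf : ContDiff ℝ 1 f) {c δ : ℝ} (hδ : 0 < δ)
    (h : ∀ s, s < δ → f s = c) (x v : Rd d) :
    fderiv ℝ (fun x : Rd d => f ‖x‖) x v = deriv f ‖x‖ * (inner ℝ x v / ‖x‖) := by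
  by_cases hx : x = 0
  · subst hx
    have : fderiv ℝ (fun x : Rd d => f ‖x‖) 0 = 0 := by
      have : (fun x : Rd d => f ‖x‖) =ᶠ[𝓝 0] fun _ => c := by
        filter_upwards [Metric.ball_mem_nhds (0 : Rd d) hδ] with y hy
        exact h _ (by simpa using hy)
      rw [this.fderiv_eq]
      simp
    simp [this]
  · have hn : ‖x‖ ≠ 0 := norm_ne_zero_iff.2 hx
    have h1 : HasFDerivAt (fun y : Rd d => Real.sqrt (‖y‖ ^ 2))
        ((1 / (2 * Real.sqrt (‖x‖ ^ 2))) • (2 • (innerSL ℝ x))) x := by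
      exact (hasStrictFDerivAt_norm_sq x).hasFDerivAt.sqrt (by positivity)
    have h2 : (fun y : Rd d => Real.sqrt (‖y‖ ^ 2)) = fun y => ‖y‖ := by
      funext y; exact Real.sqrt_sq (norm_nonneg y)
    rw [h2, Real.sqrt_sq (norm_nonneg x)] at h1
    have h3 : HasDerivAt f (deriv f ‖x‖) ‖x‖ :=
      (hf.differentiable (by norm_num) _).hasDerivAt
    have h4 := h3.comp_hasFDerivAt x h1
    rw [show (fun x : Rd d => f ‖x‖) = f ∘ fun y => ‖y‖ from rfl, h4.fderiv]
    simp
    field_simp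
    simp

theorem exists_cutoff {β : ℝ → ℝ} (hβ : Continuous β) (h0 : ∀ t, 0 ≤ β t) (h1 : ∫ t, β t = 1)
    {ε ρ : ℝ} (hερ : ε < ρ) (hε : 0 < ε) (hs : ∀ t, ε ≤ |t| → β t = 0) :
    ∃ η : ℝ → ℝ, ContDiff ℝ 1 η ∧ (∀ s, deriv η s = - β (ρ - s)) ∧
      (∀ s, s ≤ ρ - ε → η s = 1) ∧ (∀ s, ρ + ε ≤ s → η s = 0) ∧ (∀ s, 0 ≤ η s ∧ η s ≤ 1) := by
  have hc : Continuous fun t => β (ρ - t) := hβ.comp (by fun_prop)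
  have hd : ∀ s, HasDerivAt (fun s => 1 - ∫ t in (0 : ℝ)..s, β (ρ - t)) (- β (ρ - s)) s := by
    intro s
    exact (hc.integral_hasStrictDerivAt 0 s).hasDerivAt.const_sub 1
  have hd' : ∀ s, deriv (fun s => 1 - ∫ t in (0 : ℝ)..s, β (ρ - t)) s = - β (ρ - s) :=
    fun s => (hd s).deriv
  have hlow : ∀ s, s ≤ ρ - ε → 1 - ∫ t in (0 : ℝ)..s, β (ρ - t) = 1 := by
    intro s hsρ
    have : ∫ t in (0 : ℝ)..s, β (ρ - t) = ∫ t in (0 : ℝ)..s, (0 : ℝ) := by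
      refine intervalIntegral.integral_congr fun t ht => hs _ ?_
      have : t ≤ ρ - ε := by
        rw [mem_uIcc] at ht
        rcases ht with h | h <;> linarith [h.1, h.2, hε]
      rw [le_abs]; left; linarith
    rw [this]; simp
  have hhigh : ∀ s, ρ + ε ≤ s → 1 - ∫ t in (0 : ℝ)..s, β (ρ - t) = 0 := by
    intro s hsρ
    rw [intervalIntegral.integral_comp_sub_left (fun t => β t) ρ,
      intervalIntegral.integral_eq_integral_of_support_subset, h1, sub_self]
    intro t ht
    have : |t| < ε := by
      by_contra hc
      exact ht (hs t (not_lt.1 hc))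
    rw [abs_lt] at this
    constructor <;> linarith [this.1, this.2]
  have hanti : Antitone (fun s => 1 - ∫ t in (0 : ℝ)..s, β (ρ - t)) :=
    antitone_of_deriv_nonpos (fun s => (hd s).differentiableAt)
      fun s => by rw [hd']; linarith [h0 (ρ - s)]
  refine ⟨_, ?_, hd', hlow, hhigh, fun s => ⟨?_, ?_⟩⟩
  · rw [contDiff_one_iff_deriv]
    refine ⟨fun s => (hd s).differentiableAt, ?_⟩
    rw [show deriv (fun s => 1 - ∫ t in (0 : ℝ)..s, β (ρ - t)) = fun s => - β (ρ - s) from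
      funext hd']
    exact hc.neg
  · have := hanti (le_max_left s (ρ + ε))
    simp only at this
    rwa [hhigh _ (le_max_right _ _)] at this
  · have := hanti (min_le_left s (ρ - ε))
    simp only at this
    rwa [hlow _ (min_le_right _ _)] at this

theorem norm_preimage_null {d : ℕ} (hd : 0 < d) {N : Set ℝ} (hN : volume N = 0) :
    volume ((fun x : Rd d => ‖x‖) ⁻¹' N) = 0 := by
  obtain ⟨M, hNM, hM, hM0⟩ := exists_measurable_superset_of_null hN
  refine measure_mono_null (preimage_mono hNM) ?_
  have hne : Nonempty (Fin d) := ⟨⟨0, hd⟩⟩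
  have key : ∀ n : ℕ, volume ((fun x : Rd d => ‖x‖) ⁻¹' (M ∩ Iio (n : ℝ))) = 0 := by
    intro n
    have h1 := integral_fun_norm_addHaar (volume : Measure (Rd d))
      (f := (M ∩ Iio (n : ℝ)).indicator (fun _ => (1 : ℝ)))
    have h2 : ∫ y in Ioi (0 : ℝ), y ^ (Module.finrank ℝ (Rd d) - 1) •
        (M ∩ Iio (n : ℝ)).indicator (fun _ => (1 : ℝ)) y = 0 := by
      refine integral_eq_zero_of_ae ?_
      refine ae_restrict_of_ae ?_
      have : ∀ᵐ y : ℝ, y ∉ M := measure_eq_zero_iff_ae_notMem.1 hM0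
      filter_upwards [this] with y hy
      simp [hy]
    rw [h2] at h1
    have hms : MeasurableSet ((fun x : Rd d => ‖x‖) ⁻¹' (M ∩ Iio (n : ℝ))) :=
      measurable_norm (hM.inter measurableSet_Iio)
    have h3 : (fun x : Rd d => (M ∩ Iio (n : ℝ)).indicator (fun _ => (1 : ℝ)) ‖x‖) =
      ((fun x : Rd d => ‖x‖) ⁻¹' (M ∩ Iio (n : ℝ))).indicator (fun _ => (1 : ℝ)) := by
      funext x; rfl
    rw [h3, integral_indicator hms] at h1
    simp only [integral_const, smul_eq_mul, mul_one, mul_zero, smul_zero] at h1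
    rw [measureReal_restrict_apply_univ, measureReal_def, ENNReal.toReal_eq_zero_iff] at h1
    rcases h1 with h1 | h1
    · exact h1
    · exfalso
      have : volume ((fun x : Rd d => ‖x‖) ⁻¹' (M ∩ Iio (n : ℝ))) ≤ volume (ball (0 : Rd d) n) := by
        refine measure_mono fun x hx => ?_
        simpa using hx.2
      exact absurd (h1 ▸ this) (not_le.2 measure_ball_lt_top)
  have : (fun x : Rd d => ‖x‖) ⁻¹' M ⊆ ⋃ n : ℕ, (fun x : Rd d => ‖x‖) ⁻¹' (M ∩ Iio (n : ℝ)) := by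
    intro x hx
    obtain ⟨n, hn⟩ := exists_nat_gt ‖x‖
    exact mem_iUnion.2 ⟨n, hx, hn⟩
  exact measure_mono_null this (measure_iUnion_null key)

theorem density_nonneg {d : ℕ} (hd : 0 < d) {h : Rd d → ℝ} (hi : Integrable h)
    (hm : Measurable h) (h0 : ∀ x, 0 ≤ h x) :
    ∃ H : ℝ → ℝ, Integrable H ∧ (∀ s, 0 ≤ H s) ∧
      ∀ a : ℝ → ℝ, Measurable a → ∫ x : Rd d, a ‖x‖ * h x = ∫ s, a s * H s := by
  set ν : Measure ℝ := ((volume : Measure (Rd d)).withDensity (fun x => ENNReal.ofReal (h x))).map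
    (fun x => ‖x‖) with hν
  have hfin : IsFiniteMeasure ((volume : Measure (Rd d)).withDensity
    (fun x => ENNReal.ofReal (h x))) := isFiniteMeasure_withDensity_ofReal hi.2
  have hfin' : IsFiniteMeasure ν := by rw [hν]; infer_instance
  have hac : ν ≪ volume := by
    refine Measure.AbsolutelyContinuous.mk fun N hN hN0 => ?_
    rw [hν, Measure.map_apply measurable_norm hN]
    exact withDensity_absolutelyContinuous _ _ (norm_preimage_null hd hN0)
  refine ⟨fun s => (ν.rnDeriv volume s).toReal, Measure.integrable_toReal_rnDeriv,
    fun s => ENNReal.toReal_nonneg, fun a ha => ?_⟩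
  have h1 := integral_rnDeriv_smul hac (f := a)
  simp only [smul_eq_mul] at h1
  rw [show (∫ s, a s * (ν.rnDeriv volume s).toReal) = ∫ s, (ν.rnDeriv volume s).toReal * a s by
    simp only [mul_comm], h1, hν, integral_map measurable_norm.aemeasurable
    ha.aestronglyMeasurable,
    integral_withDensity_eq_integral_toReal_smul (by fun_prop) (by simp)]
  refine integral_congr_ae (Eventually.of_forall fun x => ?_)
  simp [ENNReal.toReal_ofReal (h0 x), mul_comm]

theorem bdd_mul_integrable {α : Type*} [MeasurableSpace α] {μ : Measure α} {a h : α → ℝ} {C : ℝ}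
    (hi : Integrable h μ) (ha : Measurable a) (hC : ∀ s, |a s| ≤ C) :
    Integrable (fun x => a x * h x) μ :=
  hi.bdd_mul ha.aestronglyMeasurable (Eventually.of_forall hC)

theorem density {d : ℕ} (hd : 0 < d) {h : Rd d → ℝ} (hi : Integrable h)
    (hm : Measurable h) :
    ∃ H : ℝ → ℝ, Integrable H ∧
      ∀ a : ℝ → ℝ, Measurable a → (∃ C, ∀ s, |a s| ≤ C) →
        ∫ x : Rd d, a ‖x‖ * h x = ∫ s, a s * H s := by
  obtain ⟨H1, hi1, -, hH1⟩ := density_nonneg hd (h := fun x => max (h x) 0) hi.pos_part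
    (hm.max measurable_const) (fun x => le_max_right _ _)
  obtain ⟨H2, hi2, -, hH2⟩ := density_nonneg hd (h := fun x => max (-h x) 0) hi.neg_part
    (hm.neg.max measurable_const) (fun x => le_max_right _ _)
  refine ⟨fun s => H1 s - H2 s, hi1.sub hi2, fun a ha ⟨C, hC⟩ => ?_⟩
  have e1 : ∀ x : Rd d, a ‖x‖ * h x = a ‖x‖ * max (h x) 0 - a ‖x‖ * max (-h x) 0 := by
    intro x
    rw [← mul_sub]; congr 1
    rcases le_total (h x) 0 with h | h
    · rw [max_eq_right h, max_eq_left (by linarith)]; ring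
    · rw [max_eq_left h, max_eq_right (by linarith)]; ring
  simp only [e1, mul_sub]
  have ham : Measurable fun x : Rd d => a ‖x‖ := ha.comp measurable_norm
  rw [integral_sub (bdd_mul_integrable hi.pos_part ham fun x => hC _)
    (bdd_mul_integrable hi.neg_part ham fun x => hC _), hH1 a ha, hH2 a ha,
    integral_sub (bdd_mul_integrable hi1 ha hC) (bdd_mul_integrable hi2 ha hC)]

def bmp (n : ℕ) : ContDiffBump (0 : ℝ) where
  rIn := 1 / (2 * ((n : ℝ) + 1))
  rOut := 1 / ((n : ℝ) + 1)
  rIn_pos := by positivity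
  rIn_lt_rOut := by
    apply one_div_lt_one_div_of_lt
    · positivity
    · have : (0 : ℝ) ≤ n := Nat.cast_nonneg n
      linarith

def bet (n : ℕ) : ℝ → ℝ := (bmp n).normed volume

theorem bet_cont (n : ℕ) : Continuous (bet n) := (bmp n).continuous_normed
theorem bet_nonneg (n : ℕ) (t : ℝ) : 0 ≤ bet n t := (bmp n).nonneg_normed t
theorem bet_int (n : ℕ) : ∫ t, bet n t = 1 := (bmp n).integral_normed
theorem bet_zero (n : ℕ) (t : ℝ) (h : 1 / ((n : ℝ) + 1) ≤ |t|) : bet n t = 0 := by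
  by_contra hc
  have h1 : t ∈ Function.support ((bmp n).normed volume) := hc
  rw [(bmp n).support_normed_eq] at h1
  have h2 : |t| < 1 / ((n : ℝ) + 1) := by simpa [bmp] using h1
  linarith

theorem bet_bdd (n : ℕ) : ∃ C, ∀ t, |bet n t| ≤ C := by
  have h : HasCompactSupport (bet n) := (bmp n).hasCompactSupport_normed
  exact (bet_cont n).bounded_above_of_compact_support h

theorem bet_leb {H : ℝ → ℝ} (hH : Integrable H) :
    ∀ᵐ ρ : ℝ, Tendsto (fun n => ∫ s, bet n (ρ - s) * H s) atTop (𝓝 (H ρ)) := by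
  have h1 : Tendsto (fun n : ℕ => (bmp n).rOut) atTop (𝓝 0) :=
    tendsto_one_div_add_atTop_nhds_zero_nat
  have h2 : ∀ᶠ n : ℕ in atTop, (bmp n).rOut ≤ 2 * (bmp n).rIn := by
    refine Eventually.of_forall fun n => ?_
    simp only [bmp]
    apply le_of_eq
    field_simp
  filter_upwards [ContDiffBump.ae_convolution_tendsto_right_of_locallyIntegrable
    (μ := (volume : Measure ℝ)) h1 h2 hH.locallyIntegrable] with ρ hρ
  refine hρ.congr fun n => ?_
  rw [convolution_eq_swap]
  rfl

theorem dens_leb {d : ℕ} {h : Rd d → ℝ} {H : ℝ → ℝ} (hH : Integrable H)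
    (hd : ∀ a : ℝ → ℝ, Measurable a → (∃ C, ∀ s, |a s| ≤ C) →
        ∫ x : Rd d, a ‖x‖ * h x = ∫ s, a s * H s) :
    ∀ᵐ ρ : ℝ, Tendsto (fun n => ∫ x : Rd d, bet n (ρ - ‖x‖) * h x) atTop (𝓝 (H ρ)) := by
  filter_upwards [bet_leb hH] with ρ hρ
  refine hρ.congr fun n => ?_
  obtain ⟨C, hC⟩ := bet_bdd n
  rw [← hd (fun s => bet n (ρ - s)) ((bet_cont n).comp (by fun_prop)).measurable
    ⟨C, fun s => hC _⟩]

/-- Real indicator. -/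
def ch {d : ℕ} (E : Set (Rd d)) : Rd d → ℝ := E.indicator (fun _ => 1)

theorem ch_meas {d : ℕ} {E : Set (Rd d)} (hE : MeasurableSet E) : Measurable (ch E) :=
  measurable_const.indicator hE

theorem ch_abs {d : ℕ} (E : Set (Rd d)) (x : Rd d) : |ch E x| ≤ 1 := by
  unfold ch indicator; split_ifs <;> simp

theorem ch_int {d : ℕ} {E : Set (Rd d)} (hE : MeasurableSet E) (f : Rd d → ℝ) :
    ∫ x in E, f x = ∫ x, ch E x * f x := by
  rw [← integral_indicator hE]
  congr 1; funext x
  unfold ch indicator; split_ifs <;> simp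

theorem rad_cont_bdd {d : ℕ} {φ : Rd d → Rd d} (x : Rd d) :
    |inner ℝ x (φ x) / ‖x‖| ≤ ‖φ x‖ := by
  by_cases hx : x = 0
  · simp [hx]
  · have : 0 < ‖x‖ := norm_pos_iff.2 hx
    rw [abs_div, abs_norm, div_le_iff₀ this, mul_comm]
    exact abs_real_inner_le_norm x (φ x)

theorem rad_integrable {d : ℕ} {φ : Rd d → Rd d} (h : ContDiff ℝ 1 φ) (h2 : HasCompactSupport φ) :
    Integrable (fun x => inner ℝ x (φ x) / ‖x‖) := by
  have hi : Integrable φ := h.continuous.integrable_of_hasCompactSupport h2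
  have hm : Measurable φ := h.continuous.measurable
  refine hi.norm.mono' (Measurable.aestronglyMeasurable ?_) (Eventually.of_forall fun x => rad_cont_bdd x)
  exact (measurable_id.inner hm).div measurable_norm

theorem key_n {d : ℕ} {E F : Set (Rd d)} (hE : MeasurableSet E) (hF : MeasurableSet F)
    {ρ : ℝ} (n : ℕ) (hn : 1 / ((n : ℝ) + 1) < ρ) :
    ∃ η : Rd d → ℝ, ContDiff ℝ 1 η ∧ (∀ x, 0 ≤ η x ∧ η x ≤ 1) ∧
      (∀ x, ‖x‖ ≤ ρ - 1 / ((n : ℝ) + 1) → η x = 1) ∧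
      (∀ x, ρ + 1 / ((n : ℝ) + 1) ≤ ‖x‖ → η x = 0) ∧
      ∀ φ : Rd d → Rd d, ContDiff ℝ 1 φ → HasCompactSupport φ →
        ∫ x, (ch E x * η x + ch F x * (1 - η x)) * vdiv φ x =
          (∫ x in E, vdiv (fun y => η y • φ y) x) + (∫ x in F, vdiv (fun y => (1 - η y) • φ y) x)
          + ∫ x, bet n (ρ - ‖x‖) * ((ch E x - ch F x) * (inner ℝ x (φ x) / ‖x‖)) := by
  obtain ⟨f, hf, hfd, hf1, hf0, hfb⟩ := exists_cutoff (bet_cont n) (bet_nonneg n) (bet_int n)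
    (ε := 1 / ((n : ℝ) + 1)) (ρ := ρ) hn (by positivity) (bet_zero n)
  have hpos : 0 < ρ - 1 / ((n : ℝ) + 1) := by linarith
  have hc : ContDiff ℝ 1 (fun x : Rd d => f ‖x‖) :=
    radial_contDiff hf hpos (c := 1) fun s hs => hf1 s hs.le
  have hfd' : ∀ x v : Rd d, fderiv ℝ (fun x : Rd d => f ‖x‖) x v =
      - bet n (ρ - ‖x‖) * (inner ℝ x v / ‖x‖) := fun x v => by
    rw [radial_fderiv hf hpos (c := 1) fun s hs => hf1 s hs.le, hfd]
  refine ⟨fun x => f ‖x‖, hc, fun x => hfb _, fun x hx => hf1 _ hx, fun x hx => hf0 _ hx, ?_⟩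
  intro φ hφ hφs
  have hc' : ContDiff ℝ 1 (fun x : Rd d => 1 - f ‖x‖) := contDiff_const.sub hc
  have i1 := vdiv_integrable hφ hφs
  have i2 := rad_integrable hφ hφs
  have mE := ch_meas hE
  have mF := ch_meas hF
  have mf : Measurable fun x : Rd d => f ‖x‖ := hc.continuous.measurable
  have mb : Measurable fun x : Rd d => bet n (ρ - ‖x‖) :=
    ((bet_cont n).comp (by fun_prop : Continuous fun x : Rd d => ρ - ‖x‖)).measurable
  obtain ⟨C, hC⟩ := bet_bdd n
  have i3 := bdd_mul_integrable i2 mb (fun x => hC _)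
  have bf : ∀ x : Rd d, |f ‖x‖| ≤ 1 := fun x => abs_le.2 ⟨by linarith [(hfb ‖x‖).1], (hfb ‖x‖).2⟩
  have bf' : ∀ x : Rd d, |1 - f ‖x‖| ≤ 1 := fun x =>
    abs_le.2 ⟨by linarith [(hfb ‖x‖).2], by linarith [(hfb ‖x‖).1]⟩
  have e1 : ∀ x, vdiv (fun y => f ‖y‖ • φ y) x =
      f ‖x‖ * vdiv φ x - bet n (ρ - ‖x‖) * (inner ℝ x (φ x) / ‖x‖) := fun x => by
    rw [vdiv_smul hc hφ, hfd']; ring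
  have e2 : ∀ x, vdiv (fun y => (1 - f ‖y‖) • φ y) x =
      (1 - f ‖x‖) * vdiv φ x + bet n (ρ - ‖x‖) * (inner ℝ x (φ x) / ‖x‖) := fun x => by
    rw [vdiv_smul hc' hφ, fderiv_const_sub]
    simp only [neg_apply]
    rw [hfd']; ring
  have j1 : Integrable (fun x => f ‖x‖ * vdiv φ x) := bdd_mul_integrable i1 mf bf
  have j2 : Integrable (fun x => (1 - f ‖x‖) * vdiv φ x) :=
    bdd_mul_integrable i1 (measurable_const.sub mf) bf'
  simp only [e1, e2]
  have j3 : Integrable (fun x => f ‖x‖ * vdiv φ x - bet n (ρ - ‖x‖) * (inner ℝ x (φ x) / ‖x‖)) :=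
    j1.sub i3
  have j4 : Integrable (fun x => (1 - f ‖x‖) * vdiv φ x +
    bet n (ρ - ‖x‖) * (inner ℝ x (φ x) / ‖x‖)) := j2.add i3
  rw [ch_int hE, ch_int hF, ← integral_add (bdd_mul_integrable j3 mE (ch_abs E))
    (bdd_mul_integrable j4 mF (ch_abs F)), ← integral_add]
  · congr 1; funext x; ring
  · exact (bdd_mul_integrable j3 mE (ch_abs E)).add
      (bdd_mul_integrable j4 mF (ch_abs F))
  · have := (bdd_mul_integrable i3 mE (ch_abs E)).sub (bdd_mul_integrable i3 mF (ch_abs F))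
    refine this.congr (Eventually.of_forall fun x => ?_)
    simp only [Pi.sub_apply]; ring

theorem glue_limit {d : ℕ} {E F : Set (Rd d)} (hE : MeasurableSet E) (hF : MeasurableSet F)
    {ρ : ℝ} (hρ : 0 < ρ) :
    ∃ η : ℕ → Rd d → ℝ, (∀ᶠ n : ℕ in atTop, ContDiff ℝ 1 (η n) ∧ (∀ x, 0 ≤ η n x ∧ η n x ≤ 1) ∧
      (∀ x, ‖x‖ ≤ ρ - 1 / ((n : ℝ) + 1) → η n x = 1) ∧
      (∀ x, ρ + 1 / ((n : ℝ) + 1) ≤ ‖x‖ → η n x = 0)) ∧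
      ∀ φ : Rd d → Rd d, ContDiff ℝ 1 φ → HasCompactSupport φ →
        Tendsto (fun n =>
          (∫ x in E, vdiv (fun y => η n y • φ y) x) +
          (∫ x in F, vdiv (fun y => (1 - η n y) • φ y) x)
          + ∫ x, bet n (ρ - ‖x‖) * ((ch E x - ch F x) * (inner ℝ x (φ x) / ‖x‖))) atTop
          (𝓝 (∫ x in (E ∩ ball (0 : Rd d) ρ) ∪ (F \ ball (0 : Rd d) ρ), vdiv φ x)) := by
  have key := fun (n : ℕ) (hn : 1 / ((n : ℝ) + 1) < ρ) => key_n hE hF n hn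
  choose! η h1 h2 h3 h4 h5 using key
  have h0 : Tendsto (fun n : ℕ => 1 / ((n : ℝ) + 1)) atTop (𝓝 0) :=
    tendsto_one_div_add_atTop_nhds_zero_nat
  have hev : ∀ᶠ n : ℕ in atTop, 1 / ((n : ℝ) + 1) < ρ := h0.eventually (gt_mem_nhds hρ)
  refine ⟨η, ?_, fun φ hφ hφs => ?_⟩
  · filter_upwards [hev] with n hn
    exact ⟨h1 n hn, h2 n hn, h3 n hn, h4 n hn⟩
  have hG : MeasurableSet ((E ∩ ball (0 : Rd d) ρ) ∪ (F \ ball (0 : Rd d) ρ)) :=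
    (hE.inter measurableSet_ball).union (hF.diff measurableSet_ball)
  rw [ch_int hG]
  have i1 := vdiv_integrable hφ hφs
  have hlim : Tendsto (fun n => ∫ x, (ch E x * η n x + ch F x * (1 - η n x)) * vdiv φ x) atTop
      (𝓝 (∫ x, ch ((E ∩ ball (0 : Rd d) ρ) ∪ (F \ ball (0 : Rd d) ρ)) x * vdiv φ x)) := by
    refine tendsto_integral_filter_of_dominated_convergence (fun x => 2 * |vdiv φ x|) ?_ ?_
      (i1.abs.const_mul 2) ?_
    · filter_upwards [hev] with n hn
      have m1 := (h1 n hn).continuous.measurable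
      have mE := ch_meas hE
      have mF := ch_meas hF
      have := (vdiv_continuous hφ).measurable
      exact Measurable.aestronglyMeasurable (by fun_prop)
    · filter_upwards [hev] with n hn
      refine Eventually.of_forall fun x => ?_
      rw [norm_mul, Real.norm_eq_abs, Real.norm_eq_abs]
      refine mul_le_mul_of_nonneg_right ?_ (abs_nonneg _)
      have hb := h2 n hn x
      refine (abs_add_le _ _).trans ?_
      rw [abs_mul, abs_mul]
      have a1 : |η n x| ≤ 1 := abs_le.2 ⟨by linarith, hb.2⟩
      have a2 : |1 - η n x| ≤ 1 := abs_le.2 ⟨by linarith, by linarith⟩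
      have := mul_le_one₀ (ch_abs E x) (abs_nonneg _) a1
      have := mul_le_one₀ (ch_abs F x) (abs_nonneg _) a2
      linarith
    · have hs : volume (sphere (0 : Rd d) ρ) = 0 :=
        Measure.addHaar_sphere_of_ne_zero _ _ hρ.ne'
      filter_upwards [measure_eq_zero_iff_ae_notMem.1 hs] with x hx
      have hx' : ‖x‖ ≠ ρ := by simpa using hx
      rcases lt_or_gt_of_ne hx' with hlt | hgt
      · refine tendsto_const_nhds.congr' ?_
        filter_upwards [hev, h0.eventually (gt_mem_nhds (sub_pos.2 hlt))] with n hn hn2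
        rw [h3 n hn x (by linarith)]
        have : x ∈ ball (0 : Rd d) ρ := by simpa using hlt
        rw [show ch ((E ∩ ball (0 : Rd d) ρ) ∪ (F \ ball (0 : Rd d) ρ)) x = ch E x by
          unfold ch
          by_cases hxE : x ∈ E
          · rw [indicator_of_mem hxE]; 
            have hm : x ∈ (E ∩ ball (0 : Rd d) ρ) ∪ (F \ ball (0 : Rd d) ρ) := Or.inl ⟨hxE, this⟩
            exact indicator_of_mem hm _
          · rw [indicator_of_notMem hxE, indicator_of_notMem]
            rintro (h | h)
            · exact hxE h.1
            · exact h.2 this]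
        ring
      · refine tendsto_const_nhds.congr' ?_
        filter_upwards [hev, h0.eventually (gt_mem_nhds (sub_pos.2 hgt))] with n hn hn2
        rw [h4 n hn x (by linarith)]
        have : x ∉ ball (0 : Rd d) ρ := by simpa using hgt.le
        rw [show ch ((E ∩ ball (0 : Rd d) ρ) ∪ (F \ ball (0 : Rd d) ρ)) x = ch F x by
          unfold ch
          by_cases hxE : x ∈ F
          · rw [indicator_of_mem hxE]; 
            have hm : x ∈ (E ∩ ball (0 : Rd d) ρ) ∪ (F \ ball (0 : Rd d) ρ) := Or.inr ⟨hxE, this⟩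
            exact indicator_of_mem hm _
          · rw [indicator_of_notMem hxE, indicator_of_notMem]
            rintro (h | h)
            · exact this h.2
            · exact hxE h.1]
        ring
  refine hlim.congr' ?_
  filter_upwards [hev] with n hn
  exact h5 n hn φ hφ hφs

theorem IsTest.smul {d : ℕ} {U V : Set (Rd d)} {φ : Rd d → Rd d} (h : IsTest φ U)
    {η : Rd d → ℝ} (hη : ContDiff ℝ 1 η) (hb : ∀ x, |η x| ≤ 1) (hV : tsupport η ⊆ V) :
    IsTest (fun y => η y • φ y) (U ∩ V) := by
  refine ⟨hη.smul h.cd, ?_, ?_, ?_⟩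
  · exact h.cs.smul_left (f := η)
  · exact subset_inter ((tsupport_smul_subset_right η φ).trans h.ts)
      ((tsupport_smul_subset_left η φ).trans hV)
  · intro x
    rw [norm_smul]
    exact mul_le_one₀ (hb x) (norm_nonneg _) (h.le x)

abbrev Gl {d : ℕ} (E F : Set (Rd d)) (ρ : ℝ) : Set (Rd d) :=
  (E ∩ ball (0 : Rd d) ρ) ∪ (F \ ball (0 : Rd d) ρ)

theorem Gl_meas {d : ℕ} {E F : Set (Rd d)} (hE : MeasurableSet E) (hF : MeasurableSet F) (ρ : ℝ) :
    MeasurableSet (Gl E F ρ) :=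
  (hE.inter measurableSet_ball).union (hF.diff measurableSet_ball)

theorem ch_diff_le {d : ℕ} (E F : Set (Rd d)) (R : ℝ) {x : Rd d} (hx : x ∈ ball (0 : Rd d) R)
    {t : ℝ} (ht : |t| ≤ 1) : (ch E x - ch F x) * t ≤ ch ((E ∆ F) ∩ ball (0 : Rd d) R) x := by
  have := abs_le.1 ht
  have hm : x ∈ (E ∆ F) ∩ ball (0 : Rd d) R ↔ (x ∈ E ∧ x ∉ F ∨ x ∈ F ∧ x ∉ E) := by
    rw [mem_inter_iff, mem_symmDiff]; tauto
  unfold ch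
  by_cases h1 : x ∈ E <;> by_cases h2 : x ∈ F <;>
    simp only [indicator, h1, h2, hm, if_true, if_false, not_true, not_false_iff, and_true,
      and_false, or_true, or_false, true_and, false_and] <;> linarith [this.1, this.2]

theorem boundA {d : ℕ} {E F : Set (Rd d)} (hE : MeasurableSet E) (hF : MeasurableSet F)
    (hEp : ∀ s, perimOpen E (ball (0 : Rd d) s) < ⊤)
    (hFp : ∀ s, perimOpen F (ball (0 : Rd d) s) < ⊤)
    {ρ R c δ : ℝ} (hρ : 0 < ρ) (hδ : 0 < δ) (hc0 : 0 ≤ c)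
    (hc : Tendsto (fun n => ∫ x : Rd d, bet n (ρ - ‖x‖) * ch ((E ∆ F) ∩ ball (0 : Rd d) R) x)
      atTop (𝓝 c)) :
    perimOpen (Gl E F ρ) (ball (0 : Rd d) R) ≤ perimOpen E (ball (0 : Rd d) (ρ + δ)) +
      perimOpen F (ball (0 : Rd d) R \ closedBall (0 : Rd d) (ρ - δ)) + ENNReal.ofReal c := by
  refine perimOpen_le fun φ hφ => ?_
  obtain ⟨η, hη, hlim⟩ := glue_limit hE hF hρ
  have hlim := hlim φ hφ.cd hφ.cs
  have hFp' : perimOpen F (ball (0 : Rd d) R \ closedBall (0 : Rd d) (ρ - δ)) < ⊤ :=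
    (perimOpen_mono sdiff_subset).trans_lt (hFp R)
  have h0 : Tendsto (fun n : ℕ => 1 / ((n : ℝ) + 1)) atTop (𝓝 0) :=
    tendsto_one_div_add_atTop_nhds_zero_nat
  have hle := le_of_tendsto_of_tendsto hlim (hc.const_add
    ((perimOpen E (ball (0 : Rd d) (ρ + δ))).toReal +
      (perimOpen F (ball (0 : Rd d) R \ closedBall (0 : Rd d) (ρ - δ))).toReal)) ?_
  · rw [← ENNReal.ofReal_toReal (hEp (ρ + δ)).ne, ← ENNReal.ofReal_toReal hFp'.ne,
      ← ENNReal.ofReal_add ENNReal.toReal_nonneg ENNReal.toReal_nonneg,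
      ← ENNReal.ofReal_add (by positivity) hc0]
    exact ENNReal.ofReal_le_ofReal hle
  filter_upwards [hη, h0.eventually (gt_mem_nhds hδ)] with n ⟨g1, g2, g3, g4⟩ hn
  have t1 : tsupport (η n) ⊆ ball (0 : Rd d) (ρ + δ) := by
    refine (closure_minimal (t := closedBall (0 : Rd d) (ρ + 1 / ((n : ℝ) + 1))) ?_
      isClosed_closedBall).trans (closedBall_subset_ball (by linarith))
    intro x hx
    by_contra hc
    exact hx (g4 x (by simpa using (not_le.1 (fun h => hc (by simpa using h))).le))
  have t2 : tsupport (fun x => 1 - η n x) ⊆ (closedBall (0 : Rd d) (ρ - δ))ᶜ := by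
    refine (closure_minimal (t := (ball (0 : Rd d) (ρ - 1 / ((n : ℝ) + 1)))ᶜ) ?_
      isOpen_ball.isClosed_compl).trans (compl_subset_compl.2 (closedBall_subset_ball (by linarith)))
    intro x hx hxb
    have : ‖x‖ < ρ - 1 / ((n : ℝ) + 1) := by simpa using hxb
    exact hx (by simp [g3 x this.le])
  have b1 : ∀ x, |η n x| ≤ 1 := fun x => abs_le.2 ⟨by linarith [(g2 x).1], (g2 x).2⟩
  have b2 : ∀ x, |1 - η n x| ≤ 1 := fun x => abs_le.2 ⟨by linarith [(g2 x).2], by linarith [(g2 x).1]⟩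
  have c1 := (((hφ.smul g1 b1 t1).mono inter_subset_right)).int_le (hEp (ρ + δ))
  have c2 := (hφ.smul (contDiff_const.sub g1) b2 t2).int_le
    (E := F) ((perimOpen_mono inter_subset_left).trans_lt (hFp R))
  rw [← sdiff_eq] at c2
  have c3 : ∫ x, bet n (ρ - ‖x‖) * ((ch E x - ch F x) * (inner ℝ x (φ x) / ‖x‖)) ≤
      ∫ x : Rd d, bet n (ρ - ‖x‖) * ch ((E ∆ F) ∩ ball (0 : Rd d) R) x := by
    obtain ⟨C, hC⟩ := bet_bdd n
    have mb : Measurable fun x : Rd d => bet n (ρ - ‖x‖) :=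
      ((bet_cont n).comp (by fun_prop : Continuous fun x : Rd d => ρ - ‖x‖)).measurable
    have i3 := bdd_mul_integrable (rad_integrable hφ.cd hφ.cs) mb (fun x => hC _)
    have i4 : Integrable (fun x : Rd d =>
        bet n (ρ - ‖x‖) * ((ch E x - ch F x) * (inner ℝ x (φ x) / ‖x‖))) := by
      have := (bdd_mul_integrable i3 (ch_meas hE) (ch_abs E)).sub
        (bdd_mul_integrable i3 (ch_meas hF) (ch_abs F))
      refine this.congr (Eventually.of_forall fun x => ?_)
      simp only [Pi.sub_apply]; ring
    have i5 : Integrable (ch ((E ∆ F) ∩ ball (0 : Rd d) R)) := by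
      refine (integrable_indicator_iff ((hE.symmDiff hF).inter measurableSet_ball)).2 ?_
      refine integrableOn_const ?_
      exact ((measure_mono inter_subset_right).trans_lt measure_ball_lt_top).ne
    refine integral_mono i4 (bdd_mul_integrable i5 mb (fun x => hC _)) fun x => ?_
    refine mul_le_mul_of_nonneg_left ?_ (bet_nonneg n _)
    by_cases hx : x ∈ ball (0 : Rd d) R
    · exact ch_diff_le E F R hx ((rad_cont_bdd x).trans (hφ.le x))
    · have : φ x = 0 := image_eq_zero_of_notMem_tsupport fun hc => hx (hφ.ts hc)
      simp only [this, inner_zero_right, zero_div, mul_zero]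
      exact indicator_nonneg (fun _ _ => zero_le_one) x
  linarith

theorem boundB {d : ℕ} {E F : Set (Rd d)} (hE : MeasurableSet E) (hF : MeasurableSet F)
    {ρ R δ : ℝ} (hδ : 0 < δ) (hR : ρ + δ < R) :
    perimOpen E (ball (0 : Rd d) (ρ - δ)) + perim (Gl E F ρ) (sphere (0 : Rd d) ρ) +
      perimOpen F (ball (0 : Rd d) R \ closedBall (0 : Rd d) (ρ + δ)) ≤
      perimOpen (Gl E F ρ) (ball (0 : Rd d) R) := by
  have hG := Gl_meas hE hF ρ
  have e1 : perimOpen E (ball (0 : Rd d) (ρ - δ)) =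
      perimOpen (Gl E F ρ) (ball (0 : Rd d) (ρ - δ)) := by
    refine perimOpen_congr hE hG fun x hx => ?_
    have hx' : x ∈ ball (0 : Rd d) ρ := ball_subset_ball (by linarith) hx
    simp only [Gl, mem_union, mem_inter_iff, Set.mem_sdiff, hx', and_true, not_true, and_false, or_false]
  have e2 : perimOpen F (ball (0 : Rd d) R \ closedBall (0 : Rd d) (ρ + δ)) =
      perimOpen (Gl E F ρ) (ball (0 : Rd d) R \ closedBall (0 : Rd d) (ρ + δ)) := by
    refine perimOpen_congr hF hG fun x hx => ?_
    have hx' : x ∉ ball (0 : Rd d) ρ := fun h =>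
      hx.2 (ball_subset_closedBall (ball_subset_ball (by linarith) h))
    simp only [Gl, mem_union, mem_inter_iff, Set.mem_sdiff, hx', and_false, not_false_iff, and_true,
      false_or]
  have e3 : perim (Gl E F ρ) (sphere (0 : Rd d) ρ) ≤
      perimOpen (Gl E F ρ) (ball (0 : Rd d) (ρ + δ) \ closedBall (0 : Rd d) (ρ - δ)) := by
    refine perim_le (isOpen_ball.sdiff isClosed_closedBall) fun x hx => ?_
    have : ‖x‖ = ρ := by simpa using hx
    constructor
    · simp [this, hδ]
    · simp [this, hδ]
  rw [e1, e2]
  refine le_trans (add_le_add_left (add_le_add_right e3 _) _) ?_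
  have s1 := perimOpen_add_le (E := Gl E F ρ) (U := ball (0 : Rd d) (ρ - δ))
    (V := ball (0 : Rd d) (ρ + δ) \ closedBall (0 : Rd d) (ρ - δ)) (W := ball (0 : Rd d) (ρ + δ))
    (disjoint_left.2 fun x hx hx' => hx'.2 (ball_subset_closedBall hx))
    (ball_subset_ball (by linarith)) sdiff_subset
  refine le_trans (add_le_add_left s1 _) ?_
  exact perimOpen_add_le (disjoint_left.2 fun x hx hx' => hx'.2 (ball_subset_closedBall hx))
    (ball_subset_ball (by linarith)) sdiff_subset

theorem shell_field {d : ℕ} {ρ δ : ℝ} (hδ : 0 < δ) (hδρ : δ < ρ) {ψ : Rd d → ℝ}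
    (hψ : ContDiff ℝ 1 ψ) (hψ1 : ∀ x, |ψ x| ≤ 1) :
    ∃ φ : Rd d → Rd d, IsTest φ (ball (0 : Rd d) (ρ + δ) \ closedBall (0 : Rd d) (ρ - δ)) ∧
      ∀ x, |ρ - ‖x‖| < δ / 4 → inner ℝ x (φ x) / ‖x‖ = ψ x := by
  let b : ContDiffBump ρ := ⟨δ / 4, δ / 2, by positivity, by linarith⟩
  have hb0 : ∀ s, δ / 2 ≤ |s - ρ| → b s = 0 := fun s hs => b.zero_of_le_dist (by
    rw [Real.dist_eq]; exact hs)
  have hb0' : ∀ s, s < ρ - δ / 2 → b s = 0 := fun s hs => hb0 s (by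
    rw [le_abs]; right; linarith)
  have hq : ContDiff ℝ 1 (fun s => b s * s⁻¹) := by
    rw [contDiff_iff_contDiffAt]
    intro s
    by_cases hs : s = 0
    · refine (contDiffAt_const (c := (0 : ℝ))).congr_of_eventuallyEq ?_
      filter_upwards [gt_mem_nhds (show s < ρ - δ / 2 by rw [hs]; linarith)] with t ht
      rw [hb0' t ht, zero_mul]
    · exact b.contDiff.contDiffAt.mul (contDiffAt_inv ℝ hs)
  have hq' : ContDiff ℝ 1 (fun x : Rd d => b ‖x‖ * ‖x‖⁻¹) :=
    radial_contDiff hq (δ := ρ - δ / 2) (c := 0) (by linarith)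
      fun s hs => by simp only [hb0' s hs, zero_mul]
  have hz : ∀ x : Rd d, δ / 2 ≤ |‖x‖ - ρ| → ψ x • ((b ‖x‖ * ‖x‖⁻¹) • x) = 0 := fun x hx => by
    rw [hb0 _ hx]; simp
  have hsupp : Function.support (fun x : Rd d => ψ x • ((b ‖x‖ * ‖x‖⁻¹) • x)) ⊆
      {x | |‖x‖ - ρ| ≤ δ / 2} := by
    intro x hx
    by_contra hc
    exact hx (hz x (not_le.1 hc).le)
  have hcl : IsClosed {x : Rd d | |‖x‖ - ρ| ≤ δ / 2} :=
    isClosed_le (by fun_prop) continuous_const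
  refine ⟨fun x => ψ x • ((b ‖x‖ * ‖x‖⁻¹) • x), ⟨hψ.smul (hq'.smul contDiff_id), ?_, ?_, ?_⟩, ?_⟩
  · refine HasCompactSupport.of_support_subset_isCompact
      (isCompact_closedBall (0 : Rd d) (ρ + δ / 2)) (hsupp.trans fun x hx => ?_)
    have := (abs_le.1 (show |‖x‖ - ρ| ≤ δ / 2 from hx)).2
    rw [mem_closedBall_zero_iff]; linarith
  · refine (closure_minimal hsupp hcl).trans fun x hx => ?_
    have := abs_le.1 (show |‖x‖ - ρ| ≤ δ / 2 from hx)
    refine ⟨?_, fun h => ?_⟩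
    · rw [mem_ball_zero_iff]; linarith
    · rw [mem_closedBall_zero_iff] at h; linarith
  · intro x
    rw [norm_smul, norm_smul, Real.norm_eq_abs, Real.norm_eq_abs, abs_mul, abs_inv, abs_norm]
    have h1 : |b ‖x‖| ≤ 1 := abs_le.2 ⟨by linarith [b.nonneg (x := ‖x‖)], b.le_one⟩
    have h2 : ‖x‖⁻¹ * ‖x‖ ≤ 1 := inv_mul_le_one
    refine mul_le_one₀ (hψ1 x) (by positivity) ?_
    rw [mul_assoc]
    exact mul_le_one₀ h1 (by positivity) h2
  · intro x hx
    have hx0 : ‖x‖ ≠ 0 := by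
      intro h
      rw [h, sub_zero, abs_of_pos (by linarith)] at hx
      linarith
    have hb1 : b ‖x‖ = 1 := b.one_of_mem_closedBall (by
      rw [mem_closedBall, Real.dist_eq, abs_sub_comm]; exact hx.le)
    show inner ℝ x (ψ x • (b ‖x‖ * ‖x‖⁻¹) • x) / ‖x‖ = ψ x
    rw [hb1, inner_smul_right, inner_smul_right, real_inner_self_eq_norm_sq]
    field_simp

theorem shell_subset {d : ℕ} {ρ : ℝ} (hρ : 0 < ρ) {U : Set (Rd d)} (hU : IsOpen U)
    (h : sphere (0 : Rd d) ρ ⊆ U) :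
    ∃ δ₀ > 0, ∀ δ, δ ≤ δ₀ → δ < ρ →
      ball (0 : Rd d) (ρ + δ) \ closedBall (0 : Rd d) (ρ - δ) ⊆ U := by
  obtain ⟨δ₀, h0, h1⟩ := (isCompact_sphere (0 : Rd d) ρ).exists_thickening_subset_open hU h
  refine ⟨δ₀, h0, fun δ hδ hδρ x hx => h1 ?_⟩
  have hx1 : ‖x‖ < ρ + δ := by simpa using hx.1
  have hx2 : ρ - δ < ‖x‖ := by simpa using hx.2
  have hpos : 0 < ‖x‖ := by linarith
  rw [mem_thickening_iff]
  refine ⟨(ρ / ‖x‖) • x, ?_, ?_⟩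
  · rw [mem_sphere_zero_iff_norm, norm_smul, Real.norm_eq_abs, abs_of_pos (by positivity)]
    field_simp
  · have : x - (ρ / ‖x‖) • x = (1 - ρ / ‖x‖) • x := by rw [sub_smul, one_smul]
    rw [dist_eq_norm, this, norm_smul, Real.norm_eq_abs]
    have e : |1 - ρ / ‖x‖| * ‖x‖ = |‖x‖ - ρ| := by
      rw [← abs_norm x, abs_norm x]
      conv_lhs => rw [← abs_of_pos hpos, ← abs_mul, abs_of_pos hpos]
      congr 1; field_simp
    rw [e, abs_lt]
    constructor <;> linarith


theorem boundC {d : ℕ} {E F : Set (Rd d)} (hE : MeasurableSet E) (hF : MeasurableSet F)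
    (hEp : ∀ s, perimOpen E (ball (0 : Rd d) s) < ⊤)
    (hFp : ∀ s, perimOpen F (ball (0 : Rd d) s) < ⊤)
    {ρ R c δ : ℝ} (hδ : 0 < δ) (hδρ : δ < ρ) (hδR : ρ + δ < R) {ψ : Rd d → ℝ}
    (hψ : ContDiff ℝ 1 ψ) (hψ1 : ∀ x, |ψ x| ≤ 1) {U : Set (Rd d)}
    (hU : ball (0 : Rd d) (ρ + δ) \ closedBall (0 : Rd d) (ρ - δ) ⊆ U)
    (hc : Tendsto (fun n => ∫ x : Rd d, bet n (ρ - ‖x‖) *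
      (((ch E x - ch F x) * ch (ball (0 : Rd d) R) x) * ψ x)) atTop (𝓝 c)) :
    ENNReal.ofReal c + (perimOpen E (ball (0 : Rd d) (ρ - δ)) +
      perimOpen F (ball (0 : Rd d) R \ closedBall (0 : Rd d) (ρ + δ))) ≤
    perimOpen (Gl E F ρ) U + (perimOpen E (ball (0 : Rd d) (ρ + δ)) +
      perimOpen F (ball (0 : Rd d) R \ closedBall (0 : Rd d) (ρ - δ))) := by
  obtain ⟨φ, hφ, hφψ⟩ := shell_field hδ hδρ hψ hψ1
  obtain ⟨η, hη, hlim⟩ := glue_limit hE hF (hδ.trans hδρ)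
  have hlim := hlim φ hφ.cd hφ.cs
  set S := ball (0 : Rd d) (ρ + δ) \ closedBall (0 : Rd d) (ρ - δ) with hS
  have hES : perimOpen E S < ⊤ := (perimOpen_mono sdiff_subset).trans_lt (hEp (ρ + δ))
  have hFS : perimOpen F S < ⊤ := (perimOpen_mono sdiff_subset).trans_lt (hFp (ρ + δ))
  have h0 : Tendsto (fun n : ℕ => 1 / ((n : ℝ) + 1)) atTop (𝓝 0) :=
    tendsto_one_div_add_atTop_nhds_zero_nat
  have hle := le_of_tendsto_of_tendsto hc (hlim.add_const
    ((perimOpen E S).toReal + (perimOpen F S).toReal)) ?_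
  · have m : ENNReal.ofReal c ≤ perimOpen (Gl E F ρ) U + (perimOpen E S + perimOpen F S) := by
      refine (ENNReal.ofReal_le_ofReal hle).trans (ENNReal.ofReal_add_le.trans ?_)
      rw [ENNReal.ofReal_add ENNReal.toReal_nonneg ENNReal.toReal_nonneg,
        ENNReal.ofReal_toReal hES.ne, ENNReal.ofReal_toReal hFS.ne]
      exact add_le_add_left (le_perimOpen (hφ.mono hU)) _
    have s1 : perimOpen E (ball (0 : Rd d) (ρ - δ)) + perimOpen E S ≤
        perimOpen E (ball (0 : Rd d) (ρ + δ)) :=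
      perimOpen_add_le (disjoint_left.2 fun x hx hx' => hx'.2 (ball_subset_closedBall hx))
        (ball_subset_ball (by linarith)) sdiff_subset
    have s2 : perimOpen F S + perimOpen F (ball (0 : Rd d) R \ closedBall (0 : Rd d) (ρ + δ)) ≤
        perimOpen F (ball (0 : Rd d) R \ closedBall (0 : Rd d) (ρ - δ)) :=
      perimOpen_add_le (disjoint_left.2 fun x hx hx' => hx'.2 (ball_subset_closedBall hx.1))
        (sdiff_subset_sdiff_left (ball_subset_ball (by linarith)))
        (sdiff_subset_sdiff_right (closedBall_subset_closedBall (by linarith)))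
    calc _ ≤ perimOpen (Gl E F ρ) U + (perimOpen E S + perimOpen F S) +
          (perimOpen E (ball (0 : Rd d) (ρ - δ)) +
            perimOpen F (ball (0 : Rd d) R \ closedBall (0 : Rd d) (ρ + δ))) :=
          add_le_add_left m _
      _ = perimOpen (Gl E F ρ) U + ((perimOpen E (ball (0 : Rd d) (ρ - δ)) + perimOpen E S) +
          (perimOpen F S + perimOpen F (ball (0 : Rd d) R \ closedBall (0 : Rd d) (ρ + δ)))) := by
          ring
      _ ≤ _ := add_le_add_right (add_le_add s1 s2) _
  filter_upwards [hη, h0.eventually (gt_mem_nhds (show 0 < δ / 4 by positivity))]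
    with n ⟨g1, g2, g3, g4⟩ hn
  have b1 : ∀ x, |η n x| ≤ 1 := fun x => abs_le.2 ⟨by linarith [(g2 x).1], (g2 x).2⟩
  have b2 : ∀ x, |1 - η n x| ≤ 1 := fun x => abs_le.2 ⟨by linarith [(g2 x).2], by linarith [(g2 x).1]⟩
  have c1 := (((hφ.smul g1 b1 (subset_univ _)).mono inter_subset_left)).le_int hES
  have c2 := (((hφ.smul (contDiff_const.sub g1) b2 (subset_univ _)).mono inter_subset_left)).le_int
    (E := F) hFS
  have c3 : ∫ x : Rd d, bet n (ρ - ‖x‖) * ((ch E x - ch F x) * (inner ℝ x (φ x) / ‖x‖)) =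
      ∫ x : Rd d, bet n (ρ - ‖x‖) * (((ch E x - ch F x) * ch (ball (0 : Rd d) R) x) * ψ x) := by
    refine integral_congr_ae (Eventually.of_forall fun x => ?_)
    by_cases hx : 1 / ((n : ℝ) + 1) ≤ |ρ - ‖x‖|
    · simp only [bet_zero n _ hx, zero_mul]
    · have hx' : |ρ - ‖x‖| < δ / 4 := (not_le.1 hx).trans hn
      have hxR : x ∈ ball (0 : Rd d) R := by
        rw [mem_ball_zero_iff]; linarith [(abs_lt.1 hx').1]
      have : ch (ball (0 : Rd d) R) x = 1 := by simp only [ch, indicator, hxR, if_true]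
      simp only [hφψ x hx', this, mul_one]
  linarith

/-- a.e. consequences. -/
theorem ae_cont {d : ℕ} (E F : Set (Rd d)) (R : ℝ) : ∀ᵐ ρ : ℝ,
    ContinuousAt (fun s => perimOpen E (ball (0 : Rd d) s)) ρ ∧
    ContinuousAt (fun s => perimOpen F (ball (0 : Rd d) R \ closedBall (0 : Rd d) s)) ρ := by
  have m1 : Monotone (fun s => perimOpen E (ball (0 : Rd d) s)) := fun a b h =>
    perimOpen_mono (ball_subset_ball h)
  have m2 : Antitone (fun s => perimOpen F (ball (0 : Rd d) R \ closedBall (0 : Rd d) s)) :=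
    fun a b h => perimOpen_mono (sdiff_subset_sdiff_right (closedBall_subset_closedBall h))
  filter_upwards [m1.countable_not_continuousAt.ae_notMem volume,
    m2.countable_not_continuousAt.ae_notMem volume] with ρ h1 h2
  exact ⟨not_not.1 h1, not_not.1 h2⟩

theorem tend_p (ρ : ℝ) : Tendsto (fun δ : ℝ => ρ + δ) (𝓝[>] 0) (𝓝 ρ) :=
  ((by fun_prop : Continuous fun δ : ℝ => ρ + δ).tendsto' 0 ρ (by simp)).mono_left inf_le_left
theorem tend_m (ρ : ℝ) : Tendsto (fun δ : ℝ => ρ - δ) (𝓝[>] 0) (𝓝 ρ) :=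
  ((by fun_prop : Continuous fun δ : ℝ => ρ - δ).tendsto' 0 ρ (by simp)).mono_left inf_le_left

theorem limA {d : ℕ} {E F : Set (Rd d)} (hE : MeasurableSet E) (hF : MeasurableSet F)
    (hEp : ∀ s, perimOpen E (ball (0 : Rd d) s) < ⊤)
    (hFp : ∀ s, perimOpen F (ball (0 : Rd d) s) < ⊤)
    {ρ R c : ℝ} (hρ : 0 < ρ) (hc0 : 0 ≤ c)
    (h1 : ContinuousAt (fun s => perimOpen E (ball (0 : Rd d) s)) ρ)
    (h2 : ContinuousAt (fun s => perimOpen F (ball (0 : Rd d) R \ closedBall (0 : Rd d) s)) ρ)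
    (hc : Tendsto (fun n => ∫ x : Rd d, bet n (ρ - ‖x‖) * ch ((E ∆ F) ∩ ball (0 : Rd d) R) x)
      atTop (𝓝 c)) :
    perimOpen (Gl E F ρ) (ball (0 : Rd d) R) ≤ perimOpen E (ball (0 : Rd d) ρ) +
      perimOpen F (ball (0 : Rd d) R \ closedBall (0 : Rd d) ρ) + ENNReal.ofReal c := by
  refine ge_of_tendsto (((h1.tendsto.comp (tend_p ρ)).add (h2.tendsto.comp (tend_m ρ))).add
    (tendsto_const_nhds (x := ENNReal.ofReal c))) ?_
  filter_upwards [self_mem_nhdsWithin] with δ hδ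
  exact boundA hE hF hEp hFp hρ hδ hc0 hc

theorem limB {d : ℕ} {E F : Set (Rd d)} (hE : MeasurableSet E) (hF : MeasurableSet F)
    {ρ R : ℝ} (hR : ρ < R)
    (h1 : ContinuousAt (fun s => perimOpen E (ball (0 : Rd d) s)) ρ)
    (h2 : ContinuousAt (fun s => perimOpen F (ball (0 : Rd d) R \ closedBall (0 : Rd d) s)) ρ) :
    perimOpen E (ball (0 : Rd d) ρ) + perim (Gl E F ρ) (sphere (0 : Rd d) ρ) +
      perimOpen F (ball (0 : Rd d) R \ closedBall (0 : Rd d) ρ) ≤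
      perimOpen (Gl E F ρ) (ball (0 : Rd d) R) := by
  refine le_of_tendsto (((h1.tendsto.comp (tend_m ρ)).add
    (tendsto_const_nhds (x := perim (Gl E F ρ) (sphere (0 : Rd d) ρ)))).add
    (h2.tendsto.comp (tend_p ρ))) ?_
  filter_upwards [self_mem_nhdsWithin, (tend_p ρ).eventually (gt_mem_nhds hR)] with δ hδ hδR
  exact boundB hE hF hδ hδR

theorem limC {d : ℕ} {E F : Set (Rd d)} (hE : MeasurableSet E) (hF : MeasurableSet F)
    (hEp : ∀ s, perimOpen E (ball (0 : Rd d) s) < ⊤)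
    (hFp : ∀ s, perimOpen F (ball (0 : Rd d) s) < ⊤)
    {ρ R c : ℝ} (hρ : 0 < ρ) (hR : ρ < R)
    (h1 : ContinuousAt (fun s => perimOpen E (ball (0 : Rd d) s)) ρ)
    (h2 : ContinuousAt (fun s => perimOpen F (ball (0 : Rd d) R \ closedBall (0 : Rd d) s)) ρ)
    {ψ : Rd d → ℝ} (hψ : ContDiff ℝ 1 ψ) (hψ1 : ∀ x, |ψ x| ≤ 1)
    (hc : Tendsto (fun n => ∫ x : Rd d, bet n (ρ - ‖x‖) *
      (((ch E x - ch F x) * ch (ball (0 : Rd d) R) x) * ψ x)) atTop (𝓝 c)) :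
    ENNReal.ofReal c ≤ perim (Gl E F ρ) (sphere (0 : Rd d) ρ) := by
  refine le_perim fun U hU hsU => ?_
  obtain ⟨δ₀, hδ₀, hsub⟩ := shell_subset hρ hU hsU
  have hk : perimOpen F (ball (0 : Rd d) R \ closedBall (0 : Rd d) ρ) < ⊤ :=
    (perimOpen_mono sdiff_subset).trans_lt (hFp R)
  have := le_of_tendsto_of_tendsto
    ((tendsto_const_nhds (x := ENNReal.ofReal c)).add
      ((h1.tendsto.comp (tend_m ρ)).add (h2.tendsto.comp (tend_p ρ))))
    ((tendsto_const_nhds (x := perimOpen (Gl E F ρ) U)).add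
      ((h1.tendsto.comp (tend_p ρ)).add (h2.tendsto.comp (tend_m ρ)))) ?_
  · exact (ENNReal.add_le_add_iff_right (ENNReal.add_lt_top.2 ⟨hEp ρ, hk⟩).ne).1 this
  · have hz : Tendsto (fun δ : ℝ => δ) (𝓝[>] 0) (𝓝 0) := tendsto_id.mono_left inf_le_left
    filter_upwards [self_mem_nhdsWithin, (tend_p ρ).eventually (gt_mem_nhds hR),
      hz.eventually (gt_mem_nhds hδ₀), hz.eventually (gt_mem_nhds hρ)] with δ hδ hδR hd hdρ
    exact boundC hE hF hEp hFp hδ hdρ hδR hψ hψ1 (hsub δ hd.le hdρ) hc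

theorem limK {d : ℕ} {F : Set (Rd d)} {ρ R : ℝ}
    (h2 : ContinuousAt (fun s => perimOpen F (ball (0 : Rd d) R \ closedBall (0 : Rd d) s)) ρ) :
    perim F (ball (0 : Rd d) R \ ball (0 : Rd d) ρ) =
      perimOpen F (ball (0 : Rd d) R \ closedBall (0 : Rd d) ρ) := by
  refine le_antisymm ?_ (le_perim fun U hU h => perimOpen_mono
    ((sdiff_subset_sdiff_right ball_subset_closedBall).trans h))
  refine ge_of_tendsto (h2.tendsto.comp (tend_m ρ)) ?_
  filter_upwards [self_mem_nhdsWithin] with δ hδ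
  have hδ : 0 < δ := hδ
  exact perim_le (isOpen_ball.sdiff isClosed_closedBall)
    (sdiff_subset_sdiff_right (closedBall_subset_ball (by linarith)))

theorem ofReal_int_le {α : Type*} [MeasurableSpace α] {μ : Measure α} {f : α → ℝ}
    (hf : Integrable f μ) : ENNReal.ofReal (∫ x, f x ∂μ) ≤ ∫⁻ x, ENNReal.ofReal (f x) ∂μ := by
  have h1 : ∫ x, f x ∂μ ≤ ∫ x, max (f x) 0 ∂μ :=
    integral_mono hf hf.pos_part fun x => le_max_left _ _
  refine (ENNReal.ofReal_le_ofReal h1).trans ?_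
  rw [ofReal_integral_eq_lintegral_ofReal hf.pos_part
    (Eventually.of_forall fun x => le_max_right _ _)]
  refine lintegral_mono fun x => ?_
  simp

theorem approx_sin {d : ℕ} {u : Rd d → ℝ} (hu : Integrable u)
    (hv : ∀ x, u x = 0 ∨ u x = 1 ∨ u x = -1) {ε : ℝ} (hε : 0 < ε) :
    ∃ ψ : Rd d → ℝ, ContDiff ℝ 1 ψ ∧ (∀ x, |ψ x| ≤ 1) ∧
      Integrable (fun x => |u x - ψ x|) ∧ ∫ x, |u x - ψ x| ≤ 2 * ε := by
  obtain ⟨g, hg1, hg2, hg3⟩ := MemLp.exist_eLpNorm_sub_le (p := 1) (by simp) le_rfl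
    (memLp_one_iff_integrable.2 hu) hε
  have hgi : Integrable g := hg2.continuous.integrable_of_hasCompactSupport hg1
  have hsub : Integrable (fun x => u x - g x) := hu.sub hgi
  have hle : ∀ x, |u x - Real.sin (Real.pi / 2 * g x)| ≤ 2 * |u x - g x| := fun x => by
    have e : u x = Real.sin (Real.pi / 2 * u x) := by
      rcases hv x with h | h | h <;> rw [h] <;> simp
    calc |u x - Real.sin (Real.pi / 2 * g x)|
        = |Real.sin (Real.pi / 2 * u x) - Real.sin (Real.pi / 2 * g x)| := by rw [← e]
      _ ≤ |Real.pi / 2 * u x - Real.pi / 2 * g x| := Real.abs_sin_sub_sin_le _ _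
      _ = Real.pi / 2 * |u x - g x| := by
        rw [← mul_sub, abs_mul, abs_of_pos (by positivity)]
      _ ≤ 2 * |u x - g x| := by
        refine mul_le_mul_of_nonneg_right ?_ (abs_nonneg _)
        linarith [Real.pi_le_four]
  have hc : ContDiff ℝ 1 fun x => Real.sin (Real.pi / 2 * g x) :=
    Real.contDiff_sin.comp (contDiff_const.mul (hg2.of_le (by exact_mod_cast le_top)))
  have hi : Integrable (fun x => |u x - Real.sin (Real.pi / 2 * g x)|) := by
    refine (hsub.abs.const_mul 2).mono' ?_ (Eventually.of_forall fun x => ?_)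
    · exact (hu.aestronglyMeasurable.sub hc.continuous.aestronglyMeasurable).norm
    · rw [Real.norm_eq_abs, abs_abs]; exact hle x
  refine ⟨_, hc, fun x => Real.abs_sin_le_one _, hi, ?_⟩
  refine (integral_mono hi (hsub.abs.const_mul 2) hle).trans ?_
  rw [integral_const_mul]
  refine mul_le_mul_of_nonneg_left ?_ zero_le_two
  rw [eLpNorm_one_eq_lintegral_enorm] at hg3
  have := ofReal_integral_norm_eq_lintegral_enorm hsub
  simp only [Pi.sub_apply] at hg3
  rw [← this] at hg3
  exact (ENNReal.ofReal_le_ofReal_iff hε.le).1 hg3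

theorem u_vals {d : ℕ} (E F : Set (Rd d)) (R : ℝ) (x : Rd d) :
    ((ch E x - ch F x) * ch (ball (0 : Rd d) R) x = 0 ∨
      (ch E x - ch F x) * ch (ball (0 : Rd d) R) x = 1 ∨
      (ch E x - ch F x) * ch (ball (0 : Rd d) R) x = -1) ∧
    ((ch E x - ch F x) * ch (ball (0 : Rd d) R) x) * ((ch E x - ch F x) * ch (ball (0 : Rd d) R) x)
      = ch ((E ∆ F) ∩ ball (0 : Rd d) R) x := by
  have hm : x ∈ (E ∆ F) ∩ ball (0 : Rd d) R ↔
      ((x ∈ E ∧ x ∉ F ∨ x ∈ F ∧ x ∉ E) ∧ x ∈ ball (0 : Rd d) R) := by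
    rw [mem_inter_iff, mem_symmDiff]
  generalize (E ∆ F) ∩ ball (0 : Rd d) R = A at *
  generalize ball (0 : Rd d) R = B at *
  simp only [ch, indicator]
  by_cases h1 : x ∈ E <;> by_cases h2 : x ∈ F <;> by_cases h3 : x ∈ B <;> by_cases h0 : x ∈ A <;>
    first
    | (exfalso; tauto)
    | (simp only [h0, h1, h2, h3, if_true, if_false]; norm_num)

set_option maxHeartbeats 1000000 in
theorem glueing_pos (d : ℕ) (hd : 0 < d) (E F : Set (Rd d)) (hE : MeasurableSet E)
    (hF : MeasurableSet F)
    (hEp : ∀ s, perimOpen E (ball (0 : Rd d) s) < ⊤)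
    (hFp : ∀ s, perimOpen F (ball (0 : Rd d) s) < ⊤)
    (r R : ℝ) (hr : 0 < r) :
    ∃ H : ℝ → ℝ≥0∞, AEMeasurable H (volume.restrict (Ioo r R)) ∧
      (∀ᵐ ρ ∂(volume.restrict (Ioo r R)),
        perim (Gl E F ρ) (sphere (0 : Rd d) ρ) = H ρ ∧
        perim (Gl E F ρ) (ball (0 : Rd d) R) - perim E (ball (0 : Rd d) ρ)
          - perim F (ball (0 : Rd d) R \ ball (0 : Rd d) ρ) = H ρ) ∧
      ∫⁻ ρ in Ioo r R, H ρ = volume ((E ∆ F) ∩ (ball (0 : Rd d) R \ ball (0 : Rd d) r)) := by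
  set A := (E ∆ F) ∩ ball (0 : Rd d) R with hA
  set B := (E ∆ F) ∩ (ball (0 : Rd d) R \ ball (0 : Rd d) r) with hB
  have mA : MeasurableSet A := (hE.symmDiff hF).inter measurableSet_ball
  have mB : MeasurableSet B := (hE.symmDiff hF).inter (measurableSet_ball.diff measurableSet_ball)
  have fA : volume A ≠ ⊤ := ((measure_mono inter_subset_right).trans_lt measure_ball_lt_top).ne
  have fB : volume B ≠ ⊤ :=
    ((measure_mono (inter_subset_right.trans sdiff_subset)).trans_lt measure_ball_lt_top).ne
  have iA : Integrable (ch A) := (integrable_indicator_iff mA).2 (integrableOn_const fA)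
  have iB : Integrable (ch B) := (integrable_indicator_iff mB).2 (integrableOn_const fB)
  obtain ⟨H, iH, H0, hH⟩ := density_nonneg hd iA (ch_meas mA)
    (fun x => indicator_nonneg (fun _ _ => zero_le_one) x)
  set a : ℝ → ℝ := (Ico r R).indicator (fun _ => 1) with ha
  have ma : Measurable a := measurable_const.indicator measurableSet_Ico
  have ba : ∀ s, |a s| ≤ 1 := fun s => by
    simp only [ha, indicator]; split_ifs <;> simp
  have a0 : ∀ s, 0 ≤ a s := fun s => indicator_nonneg (fun _ _ => zero_le_one) s
  have inta : ∀ f : ℝ → ℝ, ∫ s, a s * f s = ∫ s in Ioo r R, f s := fun f => by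
    rw [← integral_Ico_eq_integral_Ioo, ← integral_indicator measurableSet_Ico]
    congr 1; funext s
    simp only [ha, indicator]; split_ifs <;> simp
  have haB : ∀ x : Rd d, a ‖x‖ * ch A x = ch B x := fun x => by
    have : x ∈ B ↔ ‖x‖ ∈ Ico r R ∧ x ∈ A := by
      simp only [hA, hB, mem_inter_iff, Set.mem_sdiff, mem_ball_zero_iff, mem_Ico, not_lt]; tauto
    simp only [ha, ch, indicator]
    by_cases h1 : ‖x‖ ∈ Ico r R <;> by_cases h2 : x ∈ A <;> by_cases h0 : x ∈ B <;>
      first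
      | (exfalso; tauto)
      | (simp only [h0, h1, h2, if_true, if_false]; norm_num)
  have intB : ∫ x, ch B x = volume.real B := by
    unfold ch; rw [integral_indicator mB]; simp
  have intH : ∫ s in Ioo r R, H s = volume.real B := by
    rw [← inta, ← hH a ma, ← intB]
    congr 1; funext x; exact haB x
  have lintH : ∫⁻ s in Ioo r R, ENNReal.ofReal (H s) = volume B := by
    rw [← ofReal_integral_eq_lintegral_ofReal iH.integrableOn (Eventually.of_forall H0), intH,
      ofReal_measureReal fB]
  have mH : AEMeasurable (fun s => ENNReal.ofReal (H s)) (volume.restrict (Ioo r R)) :=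
    iH.aestronglyMeasurable.aemeasurable.ennreal_ofReal.restrict
  -- basic ae facts
  have hae : ∀ᵐ ρ : ℝ, Tendsto (fun n => ∫ x : Rd d, bet n (ρ - ‖x‖) * ch A x) atTop (𝓝 (H ρ)) :=
    dens_leb iH fun b hb _ => hH b hb
  have hk : ∀ ρ, perimOpen F (ball (0 : Rd d) R \ closedBall (0 : Rd d) ρ) < ⊤ := fun ρ =>
    (perimOpen_mono sdiff_subset).trans_lt (hFp R)
  have hab : ∀ᵐ ρ ∂(volume.restrict (Ioo r R)),
      perimOpen (Gl E F ρ) (ball (0 : Rd d) R) ≤ perimOpen E (ball (0 : Rd d) ρ) +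
        perimOpen F (ball (0 : Rd d) R \ closedBall (0 : Rd d) ρ) + ENNReal.ofReal (H ρ) ∧
      perimOpen E (ball (0 : Rd d) ρ) + perim (Gl E F ρ) (sphere (0 : Rd d) ρ) +
        perimOpen F (ball (0 : Rd d) R \ closedBall (0 : Rd d) ρ) ≤
        perimOpen (Gl E F ρ) (ball (0 : Rd d) R) ∧
      perim F (ball (0 : Rd d) R \ ball (0 : Rd d) ρ) =
        perimOpen F (ball (0 : Rd d) R \ closedBall (0 : Rd d) ρ) := by
    filter_upwards [ae_restrict_mem measurableSet_Ioo, ae_restrict_of_ae hae,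
      ae_restrict_of_ae (ae_cont E F R)] with ρ hρ h1 h2
    exact ⟨limA hE hF hEp hFp (hr.trans hρ.1) (H0 ρ) h2.1 h2.2 h1, limB hE hF hρ.2 h2.1 h2.2,
      limK h2.2⟩
  have hup : (fun ρ => perim (Gl E F ρ) (sphere (0 : Rd d) ρ)) ≤ᵐ[volume.restrict (Ioo r R)]
      fun ρ => ENNReal.ofReal (H ρ) := by
    filter_upwards [hab] with ρ h
    have hfin := (ENNReal.add_lt_top.2 ⟨hEp ρ, hk ρ⟩).ne
    refine (ENNReal.add_le_add_iff_left hfin).1 (le_trans ?_ (h.2.1.trans h.1))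
    rw [add_right_comm]
  have hlow : ∫⁻ ρ in Ioo r R, ENNReal.ofReal (H ρ) ≤
      ∫⁻ ρ in Ioo r R, perim (Gl E F ρ) (sphere (0 : Rd d) ρ) := by
    rw [lintH]
    refine ENNReal.le_of_forall_pos_le_add fun ε hε _ => ?_
    set u : Rd d → ℝ := fun x => (ch E x - ch F x) * ch (ball (0 : Rd d) R) x with hu
    have huv : ∀ x, (u x = 0 ∨ u x = 1 ∨ u x = -1) ∧ u x * u x = ch A x := fun x => by
      exact u_vals E F R x
    have mu : Measurable u := ((ch_meas hE).sub (ch_meas hF)).mul (ch_meas measurableSet_ball)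
    have iu : Integrable u := by
      refine iA.mono' mu.aestronglyMeasurable (Eventually.of_forall fun x => ?_)
      rw [← (huv x).2]
      rcases (huv x).1 with h | h | h <;> rw [h] <;> simp
    obtain ⟨ψ, hψ, hψ1, hi, hint⟩ := approx_sin iu (fun x => (huv x).1)
      (show (0 : ℝ) < ε / 2 by positivity)
    have muψ : Measurable fun x => u x * ψ x := mu.mul hψ.continuous.measurable
    have iuψ : Integrable fun x => u x * ψ x := by
      refine (bdd_mul_integrable iu hψ.continuous.measurable hψ1).congr
        (Eventually.of_forall fun x => mul_comm _ _)
    obtain ⟨K, iK, hK⟩ := density hd iuψ muψ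
    have hKae := dens_leb iK hK
    have hKle : ∀ᵐ ρ ∂(volume.restrict (Ioo r R)),
        ENNReal.ofReal (K ρ) ≤ perim (Gl E F ρ) (sphere (0 : Rd d) ρ) := by
      filter_upwards [ae_restrict_mem measurableSet_Ioo, ae_restrict_of_ae hKae,
        ae_restrict_of_ae (ae_cont E F R)] with ρ hρ h1 h2
      exact limC hE hF hEp hFp (hr.trans hρ.1) hρ.2 h2.1 h2.2 hψ hψ1 h1
    have hreal : volume.real B ≤ (∫ ρ in Ioo r R, K ρ) + ε := by
      rw [← inta, ← hK a ma ⟨1, ba⟩, ← intB]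
      have i1 : Integrable fun x : Rd d => a ‖x‖ * (u x * ψ x) :=
        bdd_mul_integrable iuψ (ma.comp measurable_norm) (fun x => ba _)
      have : ∫ x, ch B x ≤ ∫ x, (a ‖x‖ * (u x * ψ x) + |u x - ψ x|) := by
        refine integral_mono iB (i1.add hi) fun x => ?_
        show ch B x ≤ a ‖x‖ * (u x * ψ x) + |u x - ψ x|
        rw [← haB x, ← (huv x).2]
        have h1 : u x * u x - u x * ψ x ≤ |u x - ψ x| := by
          rcases (huv x).1 with h | h | h <;> rw [h]
          · simp
          · linarith [le_abs_self (1 - ψ x)]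
          · linarith [neg_le_abs (-1 - ψ x)]
        have h2 := abs_nonneg (u x - ψ x)
        have h3 := a0 ‖x‖
        have h4 := (abs_le.1 (ba ‖x‖)).2
        nlinarith [mul_le_mul_of_nonneg_left h1 h3, mul_le_mul_of_nonneg_right h4 h2]
      rw [integral_add i1 hi] at this
      linarith
    calc volume B = ENNReal.ofReal (volume.real B) := (ofReal_measureReal fB).symm
      _ ≤ ENNReal.ofReal ((∫ ρ in Ioo r R, K ρ) + ε) := ENNReal.ofReal_le_ofReal hreal
      _ ≤ ENNReal.ofReal (∫ ρ in Ioo r R, K ρ) + ENNReal.ofReal ε := ENNReal.ofReal_add_le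
      _ ≤ _ := by
        rw [ENNReal.ofReal_coe_nnreal]
        exact add_le_add_left ((ofReal_int_le iK.integrableOn).trans (lintegral_mono_ae hKle)) _
  have heq := ae_eq_of_ae_le_of_lintegral_le hup
    ((lintegral_mono_ae hup).trans_lt (lintH ▸ fB.lt_top)).ne mH hlow
  refine ⟨fun s => ENNReal.ofReal (H s), mH, ?_, lintH⟩
  filter_upwards [heq, hab] with ρ h1 h2
  refine ⟨h1, ?_⟩
  obtain ⟨h2, h3, h4⟩ := h2
  rw [h1, add_right_comm] at h3
  rw [h4, perim_open isOpen_ball, perim_open isOpen_ball, le_antisymm h2 h3, tsub_tsub]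
  exact ENNReal.add_sub_cancel_left (ENNReal.add_lt_top.2 ⟨hEp ρ, hk ρ⟩).ne

theorem perimOpen_d0 (E U : Set (Rd 0)) : perimOpen E U = 0 := by
  refine le_antisymm (perimOpen_le fun φ hφ => ?_) zero_le
  simp [vdiv]

theorem perim_d0 (E U : Set (Rd 0)) : perim E U = 0 := by
  refine le_antisymm ?_ zero_le
  exact (perim_le isOpen_univ (subset_univ _)).trans (perimOpen_d0 E univ).le

theorem glueing_ex (d : ℕ) (E F : Set (Rd d)) (hE : MeasurableSet E)
    (hF : MeasurableSet F)
    (hEp : ∀ s, perimOpen E (ball (0 : Rd d) s) < ⊤)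
    (hFp : ∀ s, perimOpen F (ball (0 : Rd d) s) < ⊤)
    (r R : ℝ) (hr : 0 < r) :
    ∃ H : ℝ → ℝ≥0∞, AEMeasurable H (volume.restrict (Ioo r R)) ∧
      (∀ᵐ ρ ∂(volume.restrict (Ioo r R)),
        perim (Gl E F ρ) (sphere (0 : Rd d) ρ) = H ρ ∧
        perim (Gl E F ρ) (ball (0 : Rd d) R) - perim E (ball (0 : Rd d) ρ)
          - perim F (ball (0 : Rd d) R \ ball (0 : Rd d) ρ) = H ρ) ∧
      ∫⁻ ρ in Ioo r R, H ρ = volume ((E ∆ F) ∩ (ball (0 : Rd d) R \ ball (0 : Rd d) r)) := by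
  rcases Nat.eq_zero_or_pos d with rfl | hd
  · refine ⟨fun _ => 0, aemeasurable_const, Eventually.of_forall fun ρ => ?_, ?_⟩
    · simp [perim_d0]
    · have : (E ∆ F) ∩ (ball (0 : Rd 0) R \ ball (0 : Rd 0) r) = ∅ := by
        refine eq_empty_of_forall_notMem fun x hx => hx.2.2 ?_
        rw [Subsingleton.elim x 0]
        exact mem_ball_self hr
      rw [this]; simp
  · exact glueing_pos d hd E F hE hF hEp hFp r R hr

/-- glueing lemma. For Caccioppoli sets `E`, `F` and
`G_ρ := (E ∩ B_ρ) ∪ (F \ B_ρ)`, for all `0 < r < R` the integral over `ρ ∈ (r,R)` of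
`P(G_ρ, ∂B_ρ)`, and likewise of `P(G_ρ,B_R) − P(E,B_ρ) − P(F,B_R \ B_ρ)`, equals
`|(E △ F) ∩ (B_R \ B_r)|`; consequently the set of radii `ρ ∈ (r,R)` where
`P(G_ρ, ∂B_ρ) ≤ |(E △ F) ∩ (B_R \ B_r)| / (R − r)` has positive measure. -/
theorem glueing (d : ℕ) (E F : Set (Rd d)) (hE : MeasurableSet E) (hF : MeasurableSet F)
    (hEper : HasLocallyFinitePerimeter E) (hFper : HasLocallyFinitePerimeter F)
    (r R : ℝ) (hr : 0 < r) (hrR : r < R) :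
    (∫⁻ ρ in Ioo r R,
        perim ((E ∩ ball (0 : Rd d) ρ) ∪ (F \ ball (0 : Rd d) ρ)) (sphere (0 : Rd d) ρ)) =
      volume ((E ∆ F) ∩ (ball (0 : Rd d) R \ ball (0 : Rd d) r)) ∧
    (∫⁻ ρ in Ioo r R,
        (perim ((E ∩ ball (0 : Rd d) ρ) ∪ (F \ ball (0 : Rd d) ρ)) (ball (0 : Rd d) R)
          - perim E (ball (0 : Rd d) ρ)
          - perim F (ball (0 : Rd d) R \ ball (0 : Rd d) ρ))) =
      volume ((E ∆ F) ∩ (ball (0 : Rd d) R \ ball (0 : Rd d) r)) ∧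
    0 < volume {ρ : ℝ | ρ ∈ Ioo r R ∧
        perim ((E ∩ ball (0 : Rd d) ρ) ∪ (F \ ball (0 : Rd d) ρ)) (sphere (0 : Rd d) ρ) ≤
          volume ((E ∆ F) ∩ (ball (0 : Rd d) R \ ball (0 : Rd d) r)) /
            ENNReal.ofReal (R - r)} := by
  obtain ⟨H, mH, hH, hint⟩ := glueing_ex d E F hE hF
    (fun s => by rw [← perim_open isOpen_ball]; exact hEper _ isOpen_ball isBounded_ball)
    (fun s => by rw [← perim_open isOpen_ball]; exact hFper _ isOpen_ball isBounded_ball) r R hr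
  have e1 : (fun ρ => perim ((E ∩ ball (0 : Rd d) ρ) ∪ (F \ ball (0 : Rd d) ρ))
      (sphere (0 : Rd d) ρ)) =ᵐ[volume.restrict (Ioo r R)] H := by
    filter_upwards [hH] with ρ h using h.1
  have i1 := (lintegral_congr_ae e1).trans hint
  refine ⟨i1, ?_, ?_⟩
  · rw [← hint]
    refine lintegral_congr_ae ?_
    filter_upwards [hH] with ρ h using h.2
  · have := measure_le_setLAverage_pos (μ := volume) (s := Ioo r R) (by simp [hrR]) (by simp)
      (mH.congr e1.symm)
    rw [setLAverage_eq, i1, Real.volume_Ioo] at this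
    exact this
end
end

section
/- Let Ω be an open subset of ℝ^d and let F = (F_1,…,F_N) be a (possibly improper) N-partition of Ω. For every k with |F_k| > 0, let x_k ∈ Ω and ρ_k > 0 be such that the balls B_{ρ_k}(x_k) are contained in Ω, are pairwise disjoint, and |F_k ∩ B_r(x_k)| > (1/2) ω_d r^d for all r ≤ ρ_k; let A be the union of these balls. Then for every vector a = (a_1,…,a_N) with ∑_{k=1}^N a_k = 0, with a_k ≥ −|F_k ∩ B_{ρ_k}(x_k)| whenever |F_k| > 0 and a_k ≥ 0 whenever |F_k| = 0, there exists an N-partition F′ = (F′_1,…,F′_N) of Ω such that for all k = 1,…,N: (1) F′_k △ F_k ⊆ A; (2) |F′_k ∩ A| = |F_k ∩ A| + a_k; (3) P(F′_k, A) ≤ P(F_k, A) + C_1 · ∑_{j=1}^N |a_j|^{1 − 1/d}, where C_1 is a constant depending only on d and N (not on F). -/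
open MeasureTheory Metric Set Filter Bornology
open scoped ENNReal symmDiff Topology

noncomputable section

/-- The volume `ω_d` of the unit ball of `ℝ^d`. -/
def unitBallVol (d : ℕ) : ℝ := (volume (ball (0 : Rd d) 1)).toReal

lemma vf_perimOpen_mono {d : ℕ} (E : Set (Rd d)) {U V : Set (Rd d)} (h : U ⊆ V) :
    perimOpen E U ≤ perimOpen E V := by
  unfold perimOpen
  refine iSup_le fun φ => iSup_le fun h1 => iSup_le fun h2 => iSup_le fun h3 => iSup_le fun h4 => ?_
  exact le_iSup_of_le φ <| le_iSup_of_le h1 <| le_iSup_of_le h2 <|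
    le_iSup_of_le (h3.trans h) <| le_iSup_of_le h4 le_rfl

lemma vf_perim_open {d : ℕ} (E : Set (Rd d)) {U : Set (Rd d)} (h : IsOpen U) :
    perim E U = perimOpen E U := by
  unfold perim
  apply le_antisymm
  · exact iInf_le_of_le U <| iInf_le_of_le h <| iInf_le_of_le le_rfl le_rfl
  · exact le_iInf fun V => le_iInf fun _ => le_iInf fun hV => vf_perimOpen_mono E hV

lemma vf_le_perimOpen {d : ℕ} (E U : Set (Rd d)) (φ : Rd d → Rd d) (h1 : ContDiff ℝ 1 φ)
    (h2 : HasCompactSupport φ) (h3 : tsupport φ ⊆ U) (h4 : ∀ x, ‖φ x‖ ≤ 1) :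
    ENNReal.ofReal (∫ x in E, vdiv φ x) ≤ perimOpen E U :=
  le_iSup_of_le φ <| le_iSup_of_le h1 <| le_iSup_of_le h2 <|
    le_iSup_of_le h3 <| le_iSup_of_le h4 le_rfl

lemma vf_perimOpen_le {d : ℕ} (E U : Set (Rd d)) (c : ℝ≥0∞)
    (H : ∀ φ : Rd d → Rd d, ContDiff ℝ 1 φ → HasCompactSupport φ → tsupport φ ⊆ U →
      (∀ x, ‖φ x‖ ≤ 1) → ENNReal.ofReal (∫ x in E, vdiv φ x) ≤ c) : perimOpen E U ≤ c :=
  iSup_le fun φ => iSup_le fun h1 => iSup_le fun h2 => iSup_le fun h3 => iSup_le fun h4 =>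
    H φ h1 h2 h3 h4

lemma vf_vdiv_continuous {d : ℕ} {φ : Rd d → Rd d} (h1 : ContDiff ℝ 1 φ) :
    Continuous (vdiv φ) := by
  unfold vdiv
  have := h1.continuous_fderiv one_ne_zero
  fun_prop

lemma vf_vdiv_cs {d : ℕ} {φ : Rd d → Rd d} (h2 : HasCompactSupport φ) :
    HasCompactSupport (vdiv φ) := by
  refine (h2.fderiv (𝕜 := ℝ)).mono ?_
  intro x hx
  rw [Function.mem_support] at hx ⊢
  intro h
  apply hx
  simp [vdiv, h]

lemma vf_vdiv_integrable {d : ℕ} {φ : Rd d → Rd d} (h1 : ContDiff ℝ 1 φ)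
    (h2 : HasCompactSupport φ) : Integrable (vdiv φ) :=
  (vf_vdiv_continuous h1).integrable_of_hasCompactSupport (vf_vdiv_cs h2)

lemma vf_integral_vdiv {d : ℕ} {φ : Rd d → Rd d} (h1 : ContDiff ℝ 1 φ)
    (h2 : HasCompactSupport φ) : ∫ x, vdiv φ x = 0 := by
  have hc := h1.continuous_fderiv one_ne_zero
  have hi : ∀ i : Fin d, Integrable
      (fun x => fderiv ℝ φ x (EuclideanSpace.single i (1 : ℝ))) := by
    intro i
    refine Continuous.integrable_of_hasCompactSupport (by fun_prop) ?_
    refine (h2.fderiv (𝕜 := ℝ)).mono ?_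
    intro x hx
    rw [Function.mem_support] at hx ⊢
    intro h
    apply hx
    simp [h]
  have hz : ∀ i : Fin d, ∫ x, fderiv ℝ φ x (EuclideanSpace.single i (1 : ℝ)) = 0 := by
    intro i
    have := integral_smul_fderiv_eq_neg_fderiv_smul_of_integrable (𝕜 := ℝ) (μ := volume)
      (f := fun _ : Rd d => (1 : ℝ)) (g := φ) (v := EuclideanSpace.single i (1 : ℝ))
      (by simp) (by simpa using hi i)
      (by simpa using h1.continuous.integrable_of_hasCompactSupport h2)
      (fun _ _ => by fun_prop) (fun x _ => (h1.differentiable one_ne_zero) x)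
    simpa using this
  unfold vdiv
  rw [integral_finsetSum]
  · refine Finset.sum_eq_zero fun i _ => ?_
    have := (EuclideanSpace.proj (𝕜 := ℝ) i : Rd d →L[ℝ] ℝ).integral_comp_comm (hi i)
    rw [hz i] at this
    simpa using this
  · intro i _
    exact (EuclideanSpace.proj (𝕜 := ℝ) i : Rd d →L[ℝ] ℝ).integrable_comp (hi i)

lemma vf_vdiv_neg {d : ℕ} (φ : Rd d → Rd d) (x : Rd d) :
    vdiv (fun y => - φ y) x = - vdiv φ x := by
  unfold vdiv
  rw [fderiv_fun_neg]
  simp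

lemma vf_vdiv_smul {d : ℕ} {η : Rd d → ℝ} {φ : Rd d → Rd d} (hη : ContDiff ℝ 1 η)
    (h1 : ContDiff ℝ 1 φ) (x : Rd d) :
    vdiv (fun y => η y • φ y) x = η x * vdiv φ x + fderiv ℝ η x (φ x) := by
  unfold vdiv
  rw [fderiv_fun_smul ((hη.differentiable one_ne_zero) x) ((h1.differentiable one_ne_zero) x)]
  have : φ x = ∑ i, φ x i • EuclideanSpace.single i (1 : ℝ) := by
    ext j
    simp [Finset.sum_apply, Pi.single_apply]
  conv_rhs => rw [this, map_sum]
  simp [Finset.sum_add_distrib, Finset.mul_sum, mul_comm]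

lemma vf_perimOpen_union {d : ℕ} (E E' U : Set (Rd d)) (hE' : MeasurableSet E')
    (hd : Disjoint E E') : perimOpen (E ∪ E') U ≤ perimOpen E U + perimOpen E' U := by
  refine vf_perimOpen_le _ _ _ fun φ h1 h2 h3 h4 => ?_
  rw [setIntegral_union hd hE' (vf_vdiv_integrable h1 h2).integrableOn
    (vf_vdiv_integrable h1 h2).integrableOn]
  exact ENNReal.ofReal_add_le.trans
    (add_le_add (vf_le_perimOpen _ _ φ h1 h2 h3 h4) (vf_le_perimOpen _ _ φ h1 h2 h3 h4))

lemma vf_perimOpen_univ {d : ℕ} (U : Set (Rd d)) : perimOpen (univ : Set (Rd d)) U = 0 := by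
  refine le_antisymm (vf_perimOpen_le _ _ _ fun φ h1 h2 h3 h4 => ?_) (zero_le)
  simp [vf_integral_vdiv h1 h2]

lemma vf_perimOpen_compl {d : ℕ} (E U : Set (Rd d)) (hE : MeasurableSet E) :
    perimOpen E U ≤ perimOpen Eᶜ U := by
  refine (vf_perimOpen_le _ _ _ fun φ h1 h2 h3 h4 => ?_)
  have hn : (∫ x in E, vdiv φ x) = ∫ x in Eᶜ, vdiv (fun y => - φ y) x := by
    simp_rw [vf_vdiv_neg]
    rw [integral_neg]
    have := integral_add_compl hE (vf_vdiv_integrable h1 h2)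
    rw [vf_integral_vdiv h1 h2] at this
    linarith
  rw [hn]
  have hs : tsupport (fun y => - φ y) = tsupport φ := by
    unfold tsupport; congr 1; ext; simp
  refine vf_le_perimOpen _ _ _ h1.neg ?_ (hs ▸ h3) (by simpa using h4)
  unfold HasCompactSupport; rw [hs]; exact h2

lemma vf_deriv_zero {t : ℝ} (ht : t < 0 ∨ 1 < t) : deriv Real.smoothTransition t = 0 := by
  rcases ht with ht | ht
  · have : Real.smoothTransition =ᶠ[𝓝 t] fun _ => (0 : ℝ) := by
      filter_upwards [Iio_mem_nhds ht] with s hs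
      exact Real.smoothTransition.zero_of_nonpos (le_of_lt hs)
    rw [this.deriv_eq]; simp
  · have : Real.smoothTransition =ᶠ[𝓝 t] fun _ => (1 : ℝ) := by
      filter_upwards [Ioi_mem_nhds ht] with s hs
      exact Real.smoothTransition.one_of_one_le (le_of_lt hs)
    rw [this.deriv_eq]; simp

lemma vf_deriv_bound : ∃ M : ℝ, 0 ≤ M ∧ ∀ t, |deriv Real.smoothTransition t| ≤ M := by
  have hc : Continuous (deriv Real.smoothTransition) :=
    (Real.smoothTransition.contDiff (n := 1)).continuous_deriv le_rfl
  obtain ⟨M, hM⟩ := (isCompact_Icc (a := (0:ℝ)) (b := 1)).exists_bound_of_continuousOn hc.continuousOn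
  refine ⟨M, (norm_nonneg _).trans (hM 0 (by simp)), fun t => ?_⟩
  by_cases ht : t ∈ Icc (0:ℝ) 1
  · exact hM t ht
  · rw [vf_deriv_zero, abs_zero]
    · exact (norm_nonneg _).trans (hM 0 (by simp))
    · simp only [mem_Icc, not_and_or, not_le] at ht; exact ht

lemma vf_ball_vol {d : ℕ} (hd : 1 ≤ d) (x : Rd d) {r : ℝ} (hr : 0 ≤ r) :
    volume.real (ball x r) = unitBallVol d * r ^ d := by
  have : Nonempty (Fin d) := ⟨⟨0, hd⟩⟩
  unfold unitBallVol Measure.real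
  rw [Measure.addHaar_ball _ _ hr, ENNReal.toReal_mul, ENNReal.toReal_ofReal (by positivity)]
  simp [mul_comm]

lemma vf_unitBallVol_pos (d : ℕ) : 0 < unitBallVol d := by
  unfold unitBallVol
  exact ENNReal.toReal_pos (measure_ball_pos _ _ one_pos).ne' measure_ball_lt_top.ne

lemma vf_pow_sub {d : ℕ} (hd : 1 ≤ d) {s r : ℝ} (hs : 0 ≤ s) (hsr : s ≤ r) :
    r ^ d - s ^ d ≤ d * (r - s) * r ^ (d - 1) := by
  have hr := hs.trans hsr
  have h : (∑ i ∈ Finset.range d, r ^ i * s ^ (d - 1 - i)) * (r - s) = r ^ d - s ^ d :=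
    (Commute.all r s).geom_sum₂_mul d
  rw [← h]
  have : (∑ i ∈ Finset.range d, r ^ i * s ^ (d - 1 - i)) ≤ ∑ i ∈ Finset.range d, r ^ (d - 1) := by
    refine Finset.sum_le_sum fun i hi => ?_
    have hi' := Finset.mem_range.1 hi
    calc r ^ i * s ^ (d - 1 - i) ≤ r ^ i * r ^ (d - 1 - i) := by gcongr
      _ = r ^ (d - 1) := by rw [← pow_add]; congr 1; omega
  simp only [Finset.sum_const, Finset.card_range, nsmul_eq_mul] at this
  have h0 : 0 ≤ r - s := by linarith
  nlinarith [mul_le_mul_of_nonneg_right this h0]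

def vfEta {d : ℕ} (x₀ : Rd d) (r s : ℝ) (x : Rd d) : ℝ :=
  Real.smoothTransition ((‖x - x₀‖ ^ 2 - s ^ 2) / (r ^ 2 - s ^ 2))

lemma vfEta_contDiff {d : ℕ} (x₀ : Rd d) (r s : ℝ) : ContDiff ℝ 1 (vfEta x₀ r s) := by
  have h0 : ContDiff ℝ 1 (fun x : Rd d => ‖x - x₀‖ ^ 2) :=
    (contDiff_id.sub contDiff_const).norm_sq ℝ
  have h1 : ContDiff ℝ 1 (fun x : Rd d => (‖x - x₀‖ ^ 2 - s ^ 2) / (r ^ 2 - s ^ 2)) :=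
    (h0.sub contDiff_const).div_const _
  have h2 : ContDiff ℝ 1 Real.smoothTransition := Real.smoothTransition.contDiff (n := 1)
  exact h2.comp h1

lemma vfEta_fderiv {d : ℕ} (x₀ : Rd d) (r s : ℝ) (x v : Rd d) :
    fderiv ℝ (vfEta x₀ r s) x v =
      deriv Real.smoothTransition ((‖x - x₀‖ ^ 2 - s ^ 2) / (r ^ 2 - s ^ 2)) *
        (2 * inner ℝ (x - x₀) v / (r ^ 2 - s ^ 2)) := by
  have hg : HasFDerivAt (fun x : Rd d => ‖x - x₀‖ ^ 2) (2 • (innerSL ℝ (x - x₀))) x := by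
    have := ((hasFDerivAt_id x).sub_const x₀).norm_sq
    simpa using this
  have hg2 : HasFDerivAt (fun x : Rd d => (‖x - x₀‖ ^ 2 - s ^ 2) / (r ^ 2 - s ^ 2))
      ((r ^ 2 - s ^ 2)⁻¹ • (2 • (innerSL ℝ (x - x₀)))) x := by
    have := (hg.sub_const (s ^ 2)).const_mul ((r ^ 2 - s ^ 2)⁻¹)
    simpa [div_eq_inv_mul] using this
  have hh : HasDerivAt Real.smoothTransition
      (deriv Real.smoothTransition ((‖x - x₀‖ ^ 2 - s ^ 2) / (r ^ 2 - s ^ 2)))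
      ((‖x - x₀‖ ^ 2 - s ^ 2) / (r ^ 2 - s ^ 2)) :=
    ((Real.smoothTransition.contDiff (n := 1)).differentiable one_ne_zero _).hasDerivAt
  have := hh.comp_hasFDerivAt x hg2
  have h2 := this.fderiv
  have h3 : vfEta x₀ r s = Real.smoothTransition ∘
    (fun x : Rd d => (‖x - x₀‖ ^ 2 - s ^ 2) / (r ^ 2 - s ^ 2)) := rfl
  rw [h3, h2]
  simp only [smul_apply, innerSL_apply_apply, smul_eq_mul, nsmul_eq_mul]
  push_cast
  ring

lemma vf_cut_step {d : ℕ} (hd : 1 ≤ d) {M : ℝ} (hM0 : 0 ≤ M)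
    (hM : ∀ t, |deriv Real.smoothTransition t| ≤ M)
    (F U : Set (Rd d)) (x₀ : Rd d) {s r : ℝ} (hs : 0 < s)
    (hsr : s < r) (φ : Rd d → Rd d) (h1 : ContDiff ℝ 1 φ)
    (h2 : HasCompactSupport φ) (h3 : tsupport φ ⊆ U) (h4 : ∀ x, ‖φ x‖ ≤ 1) :
    ENNReal.ofReal (∫ x in F, vfEta x₀ r s x * vdiv φ x) ≤
      perimOpen F U + ENNReal.ofReal (2 * M * d * unitBallVol d * r ^ (d - 1)) := by
  have : Nonempty (Fin d) := ⟨⟨0, hd⟩⟩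
  have hη := vfEta_contDiff x₀ r s
  set ψ : Rd d → Rd d := fun y => vfEta x₀ r s y • φ y with hψ
  have hψ1 : ContDiff ℝ 1 ψ := hη.smul h1
  have hsub : tsupport ψ ⊆ tsupport φ := by
    refine closure_mono fun x hx => ?_
    rw [Function.mem_support] at hx ⊢
    intro h; apply hx; simp [hψ, h]
  have hψ2 : HasCompactSupport ψ := h2.of_isClosed_subset (isClosed_tsupport _) hsub
  have hψ4 : ∀ x, ‖ψ x‖ ≤ 1 := by
    intro x
    simp only [hψ, norm_smul]
    have a1 : ‖vfEta x₀ r s x‖ ≤ 1 := by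
      rw [vfEta, Real.norm_of_nonneg (Real.smoothTransition.nonneg _)]
      exact Real.smoothTransition.le_one _
    exact mul_le_one₀ a1 (norm_nonneg _) (h4 x)
  have hle := vf_le_perimOpen F U ψ hψ1 hψ2 (hsub.trans h3) hψ4
  have hq : 0 < r ^ 2 - s ^ 2 := by nlinarith
  have hr : 0 < r := hs.trans hsr
  set D : Rd d → ℝ := fun x => fderiv ℝ (vfEta x₀ r s) x (φ x) with hD
  have hDc : Continuous D := (hη.continuous_fderiv one_ne_zero).clm_apply h1.continuous
  have hDcs : HasCompactSupport D := by
    refine h2.mono fun x hx => ?_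
    rw [Function.mem_support] at hx ⊢
    intro h; apply hx; simp [hD, h]
  have hDi : Integrable D := hDc.integrable_of_hasCompactSupport hDcs
  have hηi : Integrable (fun x => vfEta x₀ r s x * vdiv φ x) :=
    (hη.continuous.mul (vf_vdiv_continuous h1)).integrable_of_hasCompactSupport
      (vf_vdiv_cs h2).mul_left
  have hsplit : ∫ x in F, vfEta x₀ r s x * vdiv φ x = (∫ x in F, vdiv ψ x) - ∫ x in F, D x := by
    rw [← integral_sub (vf_vdiv_integrable hψ1 hψ2).integrableOn hDi.integrableOn]
    congr 1; ext x
    rw [hψ, vf_vdiv_smul hη h1]; simp [hD]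
  set S : Set (Rd d) := closedBall x₀ r \ ball x₀ s with hS
  have hDb : ∀ x, ‖D x‖ ≤ S.indicator (fun _ => 2 * M * r / (r ^ 2 - s ^ 2)) x := by
    intro x
    by_cases hx : x ∈ S
    · rw [indicator_of_mem hx]
      simp only [hD, vfEta_fderiv, Real.norm_eq_abs, abs_mul, abs_div, abs_of_pos hq]
      have hxr : ‖x - x₀‖ ≤ r := by simpa [dist_eq_norm] using hx.1
      have hin : |inner ℝ (x - x₀) (φ x)| ≤ r := by
        refine (abs_real_inner_le_norm _ _).trans ?_
        calc ‖x - x₀‖ * ‖φ x‖ ≤ r * 1 := by gcongr; exact h4 x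
          _ = r := mul_one r
      calc _ ≤ M * (|2| * r / (r ^ 2 - s ^ 2)) := by gcongr; exact hM _
        _ = _ := by rw [abs_of_pos two_pos]; ring
    · rw [indicator_of_notMem hx]
      simp only [hD, vfEta_fderiv]
      rw [vf_deriv_zero]; · simp
      simp only [hS, Set.mem_sdiff, mem_closedBall, mem_ball, not_and_or, not_le, not_not,
        dist_eq_norm] at hx
      rcases hx with hx | hx
      · right
        rw [lt_div_iff₀ hq]
        nlinarith
      · left
        apply div_neg_of_neg_of_pos _ hq
        nlinarith [norm_nonneg (x - x₀)]
  have hSm : MeasurableSet S := measurableSet_closedBall.diff measurableSet_ball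
  have hSfin : volume S ≠ ∞ := ((measure_mono sdiff_subset).trans_lt measure_closedBall_lt_top).ne
  have hSv : volume.real S = unitBallVol d * (r ^ d - s ^ d) := by
    rw [hS, measureReal_sdiff (ball_subset_closedBall.trans (closedBall_subset_closedBall hsr.le))
      measurableSet_ball measure_closedBall_lt_top.ne, vf_ball_vol hd _ hs.le]
    have : volume.real (closedBall x₀ r) = volume.real (ball x₀ r) := by
      unfold Measure.real; rw [Measure.addHaar_closedBall_eq_addHaar_ball]
    rw [this, vf_ball_vol hd _ hr.le]; ring
  have hind : Integrable (S.indicator (fun _ => 2 * M * r / (r ^ 2 - s ^ 2))) (volume : Measure (Rd d)) :=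
    (integrableOn_const hSfin).integrable_indicator hSm
  have hbound : - ∫ x in F, D x ≤ 2 * M * d * unitBallVol d * r ^ (d - 1) := by
    calc - ∫ x in F, D x ≤ ‖∫ x in F, D x‖ := neg_le_abs _
      _ ≤ ∫ x in F, ‖D x‖ := norm_integral_le_integral_norm _
      _ ≤ ∫ x, ‖D x‖ := setIntegral_le_integral hDi.norm (Eventually.of_forall fun x => norm_nonneg _)
      _ ≤ ∫ x, S.indicator (fun _ => 2 * M * r / (r ^ 2 - s ^ 2)) x :=
          integral_mono hDi.norm hind hDb
      _ = unitBallVol d * (r ^ d - s ^ d) * (2 * M * r / (r ^ 2 - s ^ 2)) := by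
          rw [integral_indicator_const _ hSm, hSv, smul_eq_mul]
      _ ≤ unitBallVol d * (d * (r - s) * r ^ (d - 1)) * (2 * M * r / (r ^ 2 - s ^ 2)) := by
          have := (vf_unitBallVol_pos d).le
          gcongr
          exact vf_pow_sub hd hs.le hsr.le
      _ = (2 * M * d * unitBallVol d * r ^ (d - 1)) * (r * (r - s) / (r ^ 2 - s ^ 2)) := by ring
      _ ≤ (2 * M * d * unitBallVol d * r ^ (d - 1)) * 1 := by
          have := (vf_unitBallVol_pos d).le
          gcongr
          rw [div_le_one hq]; nlinarith
      _ = _ := mul_one _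
  rw [hsplit, sub_eq_add_neg]
  exact ENNReal.ofReal_add_le.trans (add_le_add hle (ENNReal.ofReal_le_ofReal hbound))

lemma vf_cut {d : ℕ} (hd : 1 ≤ d) {M : ℝ} (hM0 : 0 ≤ M)
    (hM : ∀ t, |deriv Real.smoothTransition t| ≤ M)
    (F U : Set (Rd d)) (x₀ : Rd d) (r : ℝ) :
    perimOpen (F \ ball x₀ r) U ≤
      perimOpen F U + ENNReal.ofReal (2 * M * d * unitBallVol d * r ^ (d - 1)) := by
  rcases le_or_gt r 0 with hr | hr
  · rw [ball_eq_empty.2 hr, sdiff_empty]; exact le_self_add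
  refine vf_perimOpen_le _ _ _ fun φ h1 h2 h3 h4 => ?_
  set s : ℕ → ℝ := fun n => r - r / (n + 2) with hs
  have hs0 : ∀ n, 0 < s n := by
    intro n
    have : r / (n + 2) < r := div_lt_self hr (by linarith [(Nat.cast_nonneg n : (0:ℝ) ≤ n)])
    simp only [hs]; linarith
  have hs1 : ∀ n, s n < r := by
    intro n
    have : 0 < r / ((n:ℝ) + 2) := by positivity
    simp only [hs]; linarith
  have hst : Tendsto s atTop (𝓝 r) := by
    have : Tendsto (fun n : ℕ => r / ((n:ℝ) + 2)) atTop (𝓝 0) :=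
      tendsto_const_nhds.div_atTop (tendsto_atTop_add_const_right _ _ tendsto_natCast_atTop_atTop)
    simpa [hs] using this.const_sub r
  have hlim : Tendsto (fun n => ∫ x in F, vfEta x₀ r (s n) x * vdiv φ x) atTop
      (𝓝 (∫ x in F, (ball x₀ r)ᶜ.indicator (vdiv φ) x)) := by
    refine tendsto_integral_of_dominated_convergence (fun x => ‖vdiv φ x‖) ?_ ?_ ?_ ?_
    · intro n
      exact ((vfEta_contDiff x₀ r (s n)).continuous.mul (vf_vdiv_continuous h1)).aestronglyMeasurable
    · exact (vf_vdiv_integrable h1 h2).norm.integrableOn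
    · intro n
      refine Eventually.of_forall fun x => ?_
      rw [norm_mul]
      refine mul_le_of_le_one_left (norm_nonneg _) ?_
      rw [vfEta, Real.norm_of_nonneg (Real.smoothTransition.nonneg _)]
      exact Real.smoothTransition.le_one _
    · refine Eventually.of_forall fun x => ?_
      refine tendsto_const_nhds.congr' ?_
      by_cases hx : x ∈ ball x₀ r
      · have hx' : ‖x - x₀‖ < r := by simpa [dist_eq_norm] using hx
        filter_upwards [hst.eventually (lt_mem_nhds hx')] with n hn
        rw [indicator_of_notMem (by simpa using hx)]
        have : vfEta x₀ r (s n) x = 0 := by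
          refine Real.smoothTransition.zero_of_nonpos ?_
          apply div_nonpos_of_nonpos_of_nonneg
          · nlinarith [norm_nonneg (x - x₀)]
          · nlinarith [hs0 n, hs1 n]
        simp only [this, zero_mul]
      · have hx' : r ≤ ‖x - x₀‖ := by simpa [dist_eq_norm] using hx
        refine Eventually.of_forall fun n => ?_
        rw [indicator_of_mem (by simpa using hx)]
        have : vfEta x₀ r (s n) x = 1 := by
          refine Real.smoothTransition.one_of_one_le ?_
          rw [le_div_iff₀ (by nlinarith [hs0 n, hs1 n])]
          nlinarith
        simp only [this, one_mul]
  have heq : ∫ x in F, (ball x₀ r)ᶜ.indicator (vdiv φ) x = ∫ x in F \ ball x₀ r, vdiv φ x := by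
    rw [setIntegral_indicator measurableSet_ball.compl, sdiff_eq]
  rw [heq] at hlim
  refine le_of_tendsto ((ENNReal.continuous_ofReal.tendsto _).comp hlim) ?_
  exact Eventually.of_forall fun n => vf_cut_step hd hM0 hM F U x₀ (hs0 n) (hs1 n) φ h1 h2 h3 h4

lemma vf_annulus {d : ℕ} (hd : 1 ≤ d) {M : ℝ} (hM0 : 0 ≤ M)
    (hM : ∀ t, |deriv Real.smoothTransition t| ≤ M)
    (U : Set (Rd d)) (x₀ : Rd d) {s t r : ℝ} (hs0 : 0 ≤ s) (ht0 : 0 ≤ t) (hs : s ≤ r) (ht : t ≤ r) :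
    perimOpen (ball x₀ t \ ball x₀ s) U ≤
      2 * ENNReal.ofReal (2 * M * d * unitBallVol d * r ^ (d - 1)) := by
  have hω := (vf_unitBallVol_pos d).le
  have h1 : perimOpen (ball x₀ t) U ≤ ENNReal.ofReal (2 * M * d * unitBallVol d * r ^ (d - 1)) := by
    refine (vf_perimOpen_compl _ _ measurableSet_ball).trans ?_
    have := vf_cut hd hM0 hM univ U x₀ t
    rw [vf_perimOpen_univ, zero_add, ← compl_eq_univ_sdiff] at this
    exact this.trans (ENNReal.ofReal_le_ofReal (by gcongr))
  refine (vf_cut hd hM0 hM _ U x₀ s).trans ?_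
  rw [two_mul (ENNReal.ofReal _)]
  exact add_le_add h1 (ENNReal.ofReal_le_ofReal (by gcongr))

lemma vf_radius {d : ℕ} (hd : 1 ≤ d) (E : Set (Rd d)) (x : Rd d) {ρ c : ℝ} (hρ : 0 ≤ ρ)
    (hc : 0 < c) (hcE : c ≤ volume.real (E ∩ ball x ρ)) :
    ∃ r, 0 < r ∧ r ≤ ρ ∧ volume.real (E ∩ ball x r) = c := by
  set g : ℝ → ℝ := fun r => volume.real (E ∩ ball x r) with hg
  set V : ℝ → ℝ := fun r => unitBallVol d * r ^ d with hV
  have hfin : ∀ r, volume (E ∩ ball x r) ≠ ∞ := fun r =>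
    ((measure_mono inter_subset_right).trans_lt measure_ball_lt_top).ne
  have h1 : ∀ r s, 0 ≤ r → r ≤ s → g r ≤ g s ∧ g s - g r ≤ V s - V r := by
    intro r s hr hrs
    refine ⟨measureReal_mono (inter_subset_inter_right _ (ball_subset_ball hrs)) (hfin s), ?_⟩
    have hsub : E ∩ ball x s ⊆ (E ∩ ball x r) ∪ (ball x s \ ball x r) := by
      rintro y ⟨hy1, hy2⟩
      by_cases hy : y ∈ ball x r
      · exact Or.inl ⟨hy1, hy⟩
      · exact Or.inr ⟨hy2, hy⟩
    have hf2 : volume (ball x s \ ball x r) ≠ ∞ :=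
      ((measure_mono sdiff_subset).trans_lt measure_ball_lt_top).ne
    have h2 : volume.real (E ∩ ball x s) ≤ volume.real (E ∩ ball x r)
        + volume.real (ball x s \ ball x r) :=
      (measureReal_mono hsub (by simp [hfin, hf2])).trans (measureReal_union_le _ _)
    rw [measureReal_sdiff (ball_subset_ball hrs) measurableSet_ball measure_ball_lt_top.ne,
      vf_ball_vol hd x hr, vf_ball_vol hd x (hr.trans hrs)] at h2
    simp only [hg, hV]; linarith
  have hd1 : ∀ r s, 0 ≤ r → 0 ≤ s → dist (g r) (g s) ≤ dist (V r) (V s) := by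
    intro r s hr hs
    rw [Real.dist_eq, Real.dist_eq]
    rcases le_total r s with h | h
    · obtain ⟨a, b⟩ := h1 r s hr h
      rw [abs_sub_comm, abs_sub_comm (V r), abs_of_nonneg (by linarith), abs_of_nonneg (by linarith)]
      exact b
    · obtain ⟨a, b⟩ := h1 s r hs h
      rw [abs_of_nonneg (by linarith), abs_of_nonneg (by linarith)]
      exact b
  have hcont : ContinuousOn g (Icc 0 ρ) := by
    intro r hr
    have hVc : Continuous V := by fun_prop
    have := tendsto_iff_dist_tendsto_zero.1 (hVc.continuousWithinAt (s := Icc 0 ρ) (x := r))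
    refine tendsto_iff_dist_tendsto_zero.2 (squeeze_zero' (Eventually.of_forall fun _ => dist_nonneg) ?_ this)
    filter_upwards [self_mem_nhdsWithin] with s hs
    exact hd1 s r hs.1 hr.1
  have hg0 : g 0 = 0 := by simp [hg]
  obtain ⟨r, hr, hgr⟩ := intermediate_value_Icc hρ hcont (show c ∈ Icc (g 0) (g ρ) from
    ⟨by rw [hg0]; exact hc.le, hcE⟩)
  refine ⟨r, lt_of_le_of_ne hr.1 ?_, hr.2, hgr⟩
  rintro rfl
  linarith

lemma vf_split {d N : ℕ} (hd : 1 ≤ d) {M : ℝ} (hM0 : 0 ≤ M)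
    (hM : ∀ t, |deriv Real.smoothTransition t| ≤ M) (x₀ : Rd d) {r : ℝ} (hr : 0 ≤ r)
    (v : Fin N → ℝ) (hv : ∀ i, 0 ≤ v i) (hsum : ∑ i, v i = volume.real (ball x₀ r)) :
    ∃ G : Fin N → Set (Rd d), (∀ i, MeasurableSet (G i)) ∧
      (∀ i j, i ≠ j → Disjoint (G i) (G j)) ∧ (∀ i, G i ⊆ ball x₀ r) ∧
      volume (ball x₀ r \ ⋃ i, G i) = 0 ∧ (∀ i, volume.real (G i) = v i) ∧
      ∀ i U, perimOpen (G i) U ≤ 2 * ENNReal.ofReal (2 * M * d * unitBallVol d * r ^ (d - 1)) := by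
  have hω := vf_unitBallVol_pos d
  have hd0 : d ≠ 0 := by omega
  set w : ℕ → ℝ := fun j => ∑ i : Fin N with i.val < j, v i with hw
  set R : ℕ → ℝ := fun j => (w j / unitBallVol d) ^ ((d : ℝ)⁻¹) with hR
  have hw0 : ∀ j, 0 ≤ w j := fun j => Finset.sum_nonneg fun i _ => hv i
  have hwm : ∀ j k, j ≤ k → w j ≤ w k := by
    intro j k hjk
    refine Finset.sum_le_sum_of_subset_of_nonneg ?_ fun i _ _ => hv i
    intro i hi
    simp only [Finset.mem_filter, Finset.mem_univ, true_and] at hi ⊢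
    omega
  have hwt : ∀ j, w j ≤ unitBallVol d * r ^ d := by
    intro j
    rw [← vf_ball_vol hd x₀ hr, ← hsum]
    exact Finset.sum_le_sum_of_subset_of_nonneg (Finset.subset_univ _) fun i _ _ => hv i
  have hws : ∀ i : Fin N, w (i.val + 1) = w i.val + v i := by
    intro i
    have : (Finset.univ.filter fun k : Fin N => k.val < i.val + 1) =
        insert i (Finset.univ.filter fun k : Fin N => k.val < i.val) := by
      ext k
      simp only [Finset.mem_filter, Finset.mem_univ, true_and, Finset.mem_insert, Fin.ext_iff]
      omega
    simp only [hw]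
    rw [this, Finset.sum_insert (by simp), add_comm]
  have hR0 : ∀ j, 0 ≤ R j := fun j => Real.rpow_nonneg (div_nonneg (hw0 j) hω.le) _
  have hRm : ∀ j k, j ≤ k → R j ≤ R k := by
    intro j k hjk
    refine Real.rpow_le_rpow (div_nonneg (hw0 j) hω.le) ?_ (by positivity)
    exact div_le_div_of_nonneg_right (hwm j k hjk) hω.le
  have hRr : ∀ j, R j ≤ r := by
    intro j
    calc R j ≤ (r ^ d) ^ ((d : ℝ)⁻¹) := by
          refine Real.rpow_le_rpow (div_nonneg (hw0 j) hω.le) ?_ (by positivity)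
          rw [div_le_iff₀ hω, mul_comm]; exact hwt j
      _ = r := Real.pow_rpow_inv_natCast hr hd0
  have hRp : ∀ j, unitBallVol d * R j ^ d = w j := by
    intro j
    simp only [hR]
    rw [Real.rpow_inv_natCast_pow (div_nonneg (hw0 j) hω.le) hd0]
    field_simp
  set G : Fin N → Set (Rd d) := fun i => ball x₀ (R (i.val + 1)) \ ball x₀ (R i.val) with hG
  have hGm : ∀ i, MeasurableSet (G i) := fun i => measurableSet_ball.diff measurableSet_ball
  have hGd' : ∀ i j : Fin N, i.val < j.val → Disjoint (G i) (G j) := by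
    intro i j hij
    rw [Set.disjoint_left]
    intro y hy hy'
    exact hy'.2 (ball_subset_ball (hRm (i.val + 1) j.val hij) hy.1)
  have hGd : ∀ i j, i ≠ j → Disjoint (G i) (G j) := by
    intro i j hij
    rcases lt_or_gt_of_ne (fun h => hij (Fin.ext h) : i.val ≠ j.val) with h | h
    · exact hGd' i j h
    · exact (hGd' j i h).symm
  have hGs : ∀ i, G i ⊆ ball x₀ r := fun i => sdiff_subset.trans (ball_subset_ball (hRr _))
  have hGv : ∀ i, volume.real (G i) = v i := by
    intro i
    simp only [hG]
    rw [measureReal_sdiff (ball_subset_ball (hRm _ _ (Nat.le_succ _))) measurableSet_ball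
      measure_ball_lt_top.ne, vf_ball_vol hd _ (hR0 _), vf_ball_vol hd _ (hR0 _), hRp, hRp, hws]
    ring
  have hGf : ∀ i, volume (G i) ≠ ∞ := fun i =>
    ((measure_mono (hGs i)).trans_lt measure_ball_lt_top).ne
  refine ⟨G, hGm, hGd, hGs, ?_, hGv, ?_⟩
  · have hU : volume.real (⋃ i, G i) = ∑ i, v i := by
      rw [measureReal_iUnion_fintype (fun i j hij => hGd i j hij) hGm hGf]
      simp [hGv]
    have hUf : ball x₀ r \ ⋃ i, G i ⊆ ball x₀ r := sdiff_subset
    have h0 : volume.real (ball x₀ r \ ⋃ i, G i) = 0 := by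
      rw [measureReal_sdiff (iUnion_subset hGs) (MeasurableSet.iUnion hGm)
        measure_ball_lt_top.ne, hU, hsum, sub_self]
    exact (measureReal_eq_zero_iff ((measure_mono hUf).trans_lt measure_ball_lt_top).ne).1 h0
  · intro i U
    exact vf_annulus hd hM0 hM U x₀ (hR0 _) (hR0 _) (hRr _) (hRr _)

lemma vf_cut_finset {d N : ℕ} (hd : 1 ≤ d) {M : ℝ} (hM0 : 0 ≤ M)
    (hM : ∀ t, |deriv Real.smoothTransition t| ≤ M)
    (F U : Set (Rd d)) (x : Fin N → Rd d) (r : Fin N → ℝ) (S : Finset (Fin N)) :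
    perimOpen (F \ ⋃ k ∈ S, ball (x k) (r k)) U ≤ perimOpen F U +
      ∑ k ∈ S, ENNReal.ofReal (2 * M * d * unitBallVol d * r k ^ (d - 1)) := by
  induction S using Finset.induction_on with
  | empty => simp
  | insert k S hk ih =>
    have hset : F \ ⋃ j ∈ insert k S, ball (x j) (r j) =
        (F \ ⋃ j ∈ S, ball (x j) (r j)) \ ball (x k) (r k) := by
      rw [Finset.set_biUnion_insert]
      ext y
      simp only [Set.mem_sdiff, mem_union]
      tauto
    rw [hset, Finset.sum_insert hk]
    refine (vf_cut hd hM0 hM _ U (x k) (r k)).trans ?_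
    rw [add_comm (ENNReal.ofReal _), ← add_assoc]
    exact add_le_add ih le_rfl

lemma vf_union_finset {d N : ℕ} (E U : Set (Rd d)) (G : Fin N → Set (Rd d)) (S : Finset (Fin N))
    (hm : ∀ k ∈ S, MeasurableSet (G k)) (hE : ∀ k ∈ S, Disjoint E (G k))
    (hG : ∀ k ∈ S, ∀ j ∈ S, k ≠ j → Disjoint (G k) (G j)) :
    perimOpen (E ∪ ⋃ k ∈ S, G k) U ≤ perimOpen E U + ∑ k ∈ S, perimOpen (G k) U := by
  induction S using Finset.induction_on with
  | empty => simp
  | insert k S hk ih =>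
    rw [Finset.set_biUnion_insert, union_comm (G k), ← union_assoc, Finset.sum_insert hk]
    refine (vf_perimOpen_union _ _ U (hm k (by simp)) ?_).trans ?_
    · rw [disjoint_union_left]
      refine ⟨hE k (by simp), ?_⟩
      simp only [disjoint_iUnion_left]
      intro j hj
      exact hG j (by simp [hj]) k (by simp) (fun h => hk (h ▸ hj))
    · rw [add_comm (perimOpen (G k) U), ← add_assoc]
      exact add_le_add (ih (fun j hj => hm j (by simp [hj])) (fun j hj => hE j (by simp [hj]))
        (fun j hj i hi => hG j (by simp [hj]) i (by simp [hi]))) le_rfl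

lemma vf_partition_sum {d N : ℕ} {Ω : Set (Rd d)} {F : Fin N → Set (Rd d)} (hF : IsPartition Ω F)
    (x : Rd d) (r : ℝ) (hB : ball x r ⊆ Ω) :
    ∑ i, volume.real (F i ∩ ball x r) = volume.real (ball x r) := by
  obtain ⟨hm, hdj, hc⟩ := hF
  have h1 : volume (⋃ i, F i ∩ ball x r) = ∑ i, volume (F i ∩ ball x r) := by
    rw [measure_iUnion₀, tsum_fintype]
    · intro i j hij
      refine measure_mono_null ?_ (hdj i j hij)
      rintro y ⟨⟨h1, h2⟩, h3, _⟩
      exact ⟨⟨h1, h3⟩, hB h2⟩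
    · exact fun i => ((hm i).inter measurableSet_ball).nullMeasurableSet
  have h2 : volume (⋃ i, F i ∩ ball x r) = volume (ball x r) := by
    apply le_antisymm
    · exact measure_mono (iUnion_subset fun i => inter_subset_right)
    · have : ball x r ⊆ (⋃ i, F i ∩ ball x r) ∪ (Ω \ ⋃ k, F k) := by
        intro y hy
        by_cases h : y ∈ ⋃ k, F k
        · obtain ⟨k, hk⟩ := mem_iUnion.1 h
          exact Or.inl (mem_iUnion.2 ⟨k, hk, hy⟩)
        · exact Or.inr ⟨hB hy, h⟩
      refine (measure_mono this).trans ((measure_union_le _ _).trans ?_)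
      rw [hc, add_zero]
  unfold Measure.real
  rw [← h2, h1, ENNReal.toReal_sum]
  intro i _
  exact ((measure_mono inter_subset_right).trans_lt measure_ball_lt_top).ne

lemma vf_rpow {d : ℕ} (hd : 1 ≤ d) {r a : ℝ} (hr : 0 < r) (ha : unitBallVol d / 2 * r ^ d ≤ a) :
    r ^ (d - 1) ≤ (2 / unitBallVol d) ^ (1 - 1 / (d : ℝ)) * a ^ (1 - 1 / (d : ℝ)) := by
  have hω := vf_unitBallVol_pos d
  have hd1 : (1 : ℝ) ≤ d := by exact_mod_cast hd
  have ha0 : 0 ≤ a := le_trans (by positivity) ha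
  rw [← Real.mul_rpow (by positivity) ha0]
  have he : r ^ (d - 1) = (r ^ d) ^ (1 - 1 / (d : ℝ)) := by
    rw [← Real.rpow_natCast r d, ← Real.rpow_mul hr.le, ← Real.rpow_natCast]
    congr 1
    push_cast [hd]
    field_simp
  rw [he]
  refine Real.rpow_le_rpow (by positivity) ?_ ?_
  · rw [div_mul_eq_mul_div, le_div_iff₀ hω]; linarith
  · rw [sub_nonneg, div_le_one (by linarith)]; exact hd1

/-- volume fixing, possibly improper, variations. -/
theorem volume_fixing_variations (d N : ℕ) (hd : 1 ≤ d) :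
    ∃ C₁ : ℝ, 0 ≤ C₁ ∧
      ∀ (Ω : Set (Rd d)), IsOpen Ω →
      ∀ (F : Fin N → Set (Rd d)), IsPartition Ω F →
      ∀ (x : Fin N → Rd d) (ρ : Fin N → ℝ),
        -- the balls are contained in Ω
        (∀ k, 0 < volume (F k) → 0 < ρ k ∧ ball (x k) (ρ k) ⊆ Ω) →
        -- the balls are pairwise disjoint
        (∀ k j, k ≠ j → 0 < volume (F k) → 0 < volume (F j) →
          Disjoint (ball (x k) (ρ k)) (ball (x j) (ρ j))) →
        -- volume density lower bound in the balls
        (∀ k, 0 < volume (F k) → ∀ r : ℝ, 0 < r → r ≤ ρ k →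
          ENNReal.ofReal (unitBallVol d / 2 * r ^ d) < volume (F k ∩ ball (x k) r)) →
      ∀ A : Set (Rd d), A = (⋃ k, ⋃ (_ : 0 < volume (F k)), ball (x k) (ρ k)) →
      ∀ a : Fin N → ℝ, (∑ k, a k) = 0 →
        (∀ k, 0 < volume (F k) → -(volume (F k ∩ ball (x k) (ρ k))).toReal ≤ a k) →
        (∀ k, volume (F k) = 0 → 0 ≤ a k) →
        ∃ F' : Fin N → Set (Rd d), IsPartition Ω F' ∧
          ∀ k : Fin N,
            (F' k ∆ F k ⊆ A) ∧
            (volume (F' k ∩ A)).toReal = (volume (F k ∩ A)).toReal + a k ∧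
            perim (F' k) A ≤ perim (F k) A +
              ENNReal.ofReal (C₁ * ∑ j, |a j| ^ (1 - 1 / (d : ℝ))) := by
  obtain ⟨M, hM0, hM⟩ := vf_deriv_bound
  have hω := vf_unitBallVol_pos d
  set K : ℝ := 2 * M * d * unitBallVol d with hK
  have hK0 : 0 ≤ K := by positivity
  set L : ℝ := (2 / unitBallVol d) ^ (1 - 1 / (d : ℝ)) with hL
  have hL0 : 0 ≤ L := by positivity
  refine ⟨3 * (K * L), by positivity, ?_⟩
  intro Ω hΩ F hF x ρ hball hdisj hdens A hA a hsum hneg hpos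
  have hAo : IsOpen A := by
    rw [hA]; exact isOpen_iUnion fun k => isOpen_iUnion fun _ => isOpen_ball
  have hAfin : volume A ≠ ∞ := by
    have : Bornology.IsBounded A := by
      rw [hA]
      refine (Bornology.isBounded_iUnion).2 fun k => ?_
      exact isBounded_ball.subset (iUnion_subset fun _ => Subset.rfl)
    exact this.measure_lt_top.ne
  have hvol : ∀ k, a k < 0 → 0 < volume (F k) := by
    intro k hk
    rcases eq_or_ne (volume (F k)) 0 with h | h
    · exact absurd (hpos k h) (not_le.2 hk)
    · exact pos_iff_ne_zero.2 h
  have hrad : ∀ k, ∃ r, a k < 0 → 0 < r ∧ r ≤ ρ k ∧ volume.real (F k ∩ ball (x k) r) = - a k := by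
    intro k
    by_cases hk : a k < 0
    · obtain ⟨r, h1, h2, h3⟩ := vf_radius hd (F k) (x k) (ρ := ρ k) (c := - a k)
        (hball k (hvol k hk)).1.le (by linarith) (by have := hneg k (hvol k hk); unfold Measure.real; linarith)
      exact ⟨r, fun _ => ⟨h1, h2, h3⟩⟩
    · exact ⟨0, fun h => absurd h hk⟩
  choose r hr using hrad
  set S : Finset (Fin N) := Finset.univ.filter fun k => a k < 0 with hS
  have memS : ∀ k, k ∈ S ↔ a k < 0 := by intro k; simp [hS]
  have hsubA : ∀ k ∈ S, ball (x k) (r k) ⊆ A := by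
    intro k hk
    have hk' := (memS k).1 hk
    rw [hA]
    refine subset_iUnion_of_subset k (subset_iUnion_of_subset (hvol k hk') ?_)
    exact ball_subset_ball (hr k hk').2.1
  have hsubΩ : ∀ k ∈ S, ball (x k) (r k) ⊆ Ω := by
    intro k hk
    have hk' := (memS k).1 hk
    exact (ball_subset_ball (hr k hk').2.1).trans (hball k (hvol k hk')).2
  have hBd : ∀ k ∈ S, ∀ j ∈ S, k ≠ j → Disjoint (ball (x k) (r k)) (ball (x j) (r j)) := by
    intro k hk j hj hkj
    have hk' := (memS k).1 hk
    have hj' := (memS j).1 hj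
    exact (hdisj k j hkj (hvol k hk') (hvol j hj')).mono (ball_subset_ball (hr k hk').2.1)
      (ball_subset_ball (hr j hj').2.1)
  -- transfer matrix
  set p : Fin N → ℝ := fun i => max (a i) 0 with hp
  have hp0 : ∀ i, 0 ≤ p i := fun i => le_max_right _ _
  set T : ℝ := ∑ k ∈ S, - a k with hT
  have hpa : ∀ i, p i - (if i ∈ S then - a i else 0) = a i := by
    intro i
    simp only [memS, hp]
    split_ifs with h
    · rw [max_eq_right h.le]; ring
    · rw [max_eq_left (not_lt.1 h)]; ring
  have hTp : ∑ i, p i = T := by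
    have h1 : ∑ i, (p i - (if i ∈ S then - a i else 0)) = 0 := by
      exact (Finset.sum_congr rfl fun i _ => hpa i).trans hsum
    rw [Finset.sum_sub_distrib, Finset.sum_ite_mem, Finset.univ_inter] at h1
    linarith
  have hT0 : 0 ≤ T := Finset.sum_nonneg fun k hk => by linarith [(memS k).1 hk]
  have hTpos : ∀ k ∈ S, 0 < T := by
    intro k hk
    exact Finset.sum_pos (fun j hj => by linarith [(memS j).1 hj]) ⟨k, hk⟩
  set t : Fin N → Fin N → ℝ := fun k i => (- a k) * p i / T - (if i = k then - a k else 0) with ht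
  have ht1 : ∀ k ∈ S, ∑ i, t k i = 0 := by
    intro k hk
    have := hTpos k hk
    simp only [ht]
    rw [Finset.sum_sub_distrib, ← Finset.sum_div, ← Finset.mul_sum, hTp]
    simp
    field_simp
    ring
  have ht2 : ∀ i, ∑ k ∈ S, t k i = a i := by
    intro i
    simp only [ht]
    rw [Finset.sum_sub_distrib, ← Finset.sum_div, ← Finset.sum_mul, ← hT, Finset.sum_ite_eq]
    have : T * p i / T = p i := by
      rcases hT0.eq_or_lt with h | h
      · have : p i = 0 := by
          have h2 := Finset.single_le_sum (fun j _ => hp0 j) (Finset.mem_univ i)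
          rw [hTp] at h2
          linarith [hp0 i]
        simp [this]
      · field_simp
    rw [this]; exact hpa i
  have hG : ∀ k, ∃ G : Fin N → Set (Rd d), k ∈ S → (∀ i, MeasurableSet (G i)) ∧
      (∀ i j, i ≠ j → Disjoint (G i) (G j)) ∧ (∀ i, G i ⊆ ball (x k) (r k)) ∧
      volume (ball (x k) (r k) \ ⋃ i, G i) = 0 ∧
      (∀ i, volume.real (G i) = volume.real (F i ∩ ball (x k) (r k)) + t k i) ∧
      ∀ i U, perimOpen (G i) U ≤ 2 * ENNReal.ofReal (K * r k ^ (d - 1)) := by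
    intro k
    by_cases hk : k ∈ S
    · have hk' := (memS k).1 hk
      obtain ⟨G, hG⟩ := vf_split hd hM0 hM (x k) (hr k hk').1.le
        (fun i => volume.real (F i ∩ ball (x k) (r k)) + t k i) (by
          intro i
          have h0 : 0 ≤ (- a k) * p i / T :=
            div_nonneg (mul_nonneg (by linarith) (hp0 i)) hT0
          simp only [ht]
          split_ifs with h
          · subst h; rw [(hr i hk').2.2]; linarith
          · have : 0 ≤ volume.real (F i ∩ ball (x k) (r k)) := measureReal_nonneg
            linarith) (by
          rw [Finset.sum_add_distrib, ht1 k hk, add_zero,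
            vf_partition_sum hF _ _ (hsubΩ k hk)])
      exact ⟨G, fun _ => hG⟩
    · exact ⟨fun _ => ∅, fun h => absurd h hk⟩
  choose G hG using hG
  set D : Set (Rd d) := ⋃ k ∈ S, ball (x k) (r k) with hD
  have hDm : MeasurableSet D := Finset.measurableSet_biUnion _ fun k _ => measurableSet_ball
  have hDA : D ⊆ A := iUnion₂_subset hsubA
  have hGB : ∀ k ∈ S, ∀ i, G k i ⊆ ball (x k) (r k) := fun k hk => (hG k hk).2.2.1
  have hBD : ∀ k ∈ S, ball (x k) (r k) ⊆ D := fun k hk =>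
    subset_biUnion_of_mem (u := fun k => ball (x k) (r k)) hk
  have hGD : ∀ k ∈ S, ∀ i, G k i ⊆ D := fun k hk i => (hGB k hk i).trans (hBD k hk)
  have hGdd : ∀ i, ∀ k ∈ S, ∀ j ∈ S, k ≠ j → Disjoint (G k i) (G j i) := fun i k hk j hj hkj =>
    (hBd k hk j hj hkj).mono (hGB k hk i) (hGB j hj i)
  have hGm : ∀ k ∈ S, ∀ i, MeasurableSet (G k i) := fun k hk => (hG k hk).1
  have hUD : ∀ i, (⋃ k ∈ S, G k i) ⊆ D := fun i => iUnion₂_subset fun k hk => hGD k hk i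
  have hUm : ∀ i, MeasurableSet (⋃ k ∈ S, G k i) := fun i =>
    Finset.measurableSet_biUnion _ fun k hk => hGm k hk i
  refine ⟨fun i => (F i \ D) ∪ ⋃ k ∈ S, G k i, ⟨?_, ?_, ?_⟩, ?_⟩
  · exact fun i => ((hF.1 i).diff hDm).union (hUm i)
  · intro i j hij
    refine measure_mono_null ?_ (hF.2.1 i j hij)
    rintro y ⟨⟨h1, h2⟩, h3⟩
    rcases h1 with h1 | h1
    · rcases h2 with h2 | h2
      · exact ⟨⟨h1.1, h2.1⟩, h3⟩
      · exact absurd (hUD j h2) h1.2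
    · rcases h2 with h2 | h2
      · exact absurd (hUD i h1) h2.2
      · exfalso
        simp only [mem_iUnion, exists_prop] at h1 h2
        obtain ⟨k, hk, hyk⟩ := h1
        obtain ⟨l, hl, hyl⟩ := h2
        by_cases hkl : k = l
        · subst hkl
          exact Set.disjoint_left.1 ((hG k hk).2.1 i j hij) hyk hyl
        · exact Set.disjoint_left.1 (hBd k hk l hl hkl) (hGB k hk i hyk) (hGB l hl j hyl)
  · have hnull : volume ((Ω \ ⋃ k, F k) ∪ ⋃ k ∈ S, (ball (x k) (r k) \ ⋃ i, G k i)) = 0 := by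
      refine measure_union_null hF.2.2 ?_
      refine (measure_biUnion_null_iff S.countable_toSet).2 fun k hk => (hG k hk).2.2.2.1
    refine measure_mono_null ?_ hnull
    rintro y ⟨hy, hy2⟩
    simp only [mem_iUnion, mem_union, not_exists, not_or] at hy2
    by_cases hyD : y ∈ D
    · right
      simp only [hD, mem_iUnion, exists_prop] at hyD
      obtain ⟨k, hk, hyk⟩ := hyD
      simp only [mem_iUnion, exists_prop]
      refine ⟨k, hk, hyk, ?_⟩
      intro h
      obtain ⟨i, hi⟩ := mem_iUnion.1 h
      exact (hy2 i).2 k hk hi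
    · left
      refine ⟨hy, fun h => ?_⟩
      obtain ⟨i, hi⟩ := mem_iUnion.1 h
      exact (hy2 i).1 ⟨hi, hyD⟩
  intro i
  have hfin : ∀ X : Set (Rd d), X ⊆ A → volume X ≠ ∞ := fun X hX =>
    ((measure_mono hX).trans_lt hAfin.lt_top).ne
  refine ⟨?_, ?_, ?_⟩
  · refine Subset.trans ?_ hDA
    rintro y (⟨h1, h2⟩ | ⟨h1, h2⟩)
    · rcases h1 with h1 | h1
      · exact absurd h1.1 h2
      · exact hUD i h1
    · by_contra hy
      exact h2 (Or.inl ⟨h1, hy⟩)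
  · have hset : ((F i \ D) ∪ ⋃ k ∈ S, G k i) ∩ A = ((F i ∩ A) \ (F i ∩ D)) ∪ ⋃ k ∈ S, G k i := by
      ext y
      have h1 := @hDA y
      have h2 := @hUD i y
      simp only [mem_inter_iff, mem_union, Set.mem_sdiff]
      tauto
    have hFD : F i ∩ D = ⋃ k ∈ S, F i ∩ ball (x k) (r k) := by
      rw [hD, inter_iUnion₂]
    have e1 : volume.real (F i ∩ D) = ∑ k ∈ S, volume.real (F i ∩ ball (x k) (r k)) := by
      rw [hFD, measureReal_biUnion_finset (h := fun k hk => hfin _ (inter_subset_right.trans (hsubA k hk)))]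
      · intro k hk j hj hkj
        exact (hBd k hk j hj hkj).mono inter_subset_right inter_subset_right
      · exact fun k _ => (hF.1 i).inter measurableSet_ball
    have e2 : volume.real (⋃ k ∈ S, G k i) =
        ∑ k ∈ S, volume.real (F i ∩ ball (x k) (r k)) + a i := by
      rw [measureReal_biUnion_finset (h := fun k hk => hfin _ ((hGB k hk i).trans (hsubA k hk)))]
      · rw [← ht2 i, ← Finset.sum_add_distrib]
        exact Finset.sum_congr rfl fun k hk => (hG k hk).2.2.2.2.1 i
      · intro k hk j hj hkj
        exact hGdd i k hk j hj hkj
      · exact fun k hk => hGm k hk i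
    change volume.real (((F i \ D) ∪ ⋃ k ∈ S, G k i) ∩ A) = volume.real (F i ∩ A) + a i
    rw [hset, measureReal_union _ (hUm i) (hfin _ (sdiff_subset.trans inter_subset_right))
      (hfin _ ((hUD i).trans hDA)),
      measureReal_sdiff (inter_subset_inter_right _ hDA) ((hF.1 i).inter hDm)
      (hfin _ inter_subset_right), e1, e2]
    · ring
    · rw [Set.disjoint_left]
      intro y hy hy2
      exact hy.2 ⟨hy.1.1, hUD i hy2⟩
  · rw [vf_perim_open _ hAo, vf_perim_open _ hAo]
    refine (vf_union_finset _ A (fun k => G k i) S (fun k hk => hGm k hk i) ?_ (hGdd i)).trans ?_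
    · intro k hk
      rw [Set.disjoint_left]
      intro y hy hy2
      exact hy.2 (hGD k hk i hy2)
    refine (add_le_add (vf_cut_finset hd hM0 hM (F i) A x r S)
      (Finset.sum_le_sum fun k hk => (hG k hk).2.2.2.2.2 i A)).trans ?_
    rw [add_assoc, ← Finset.sum_add_distrib]
    refine add_le_add le_rfl ?_
    have hk : ∀ k ∈ S, ENNReal.ofReal (2 * M * d * unitBallVol d * r k ^ (d - 1)) +
        2 * ENNReal.ofReal (K * r k ^ (d - 1)) ≤
        ENNReal.ofReal (3 * (K * L) * |a k| ^ (1 - 1 / (d : ℝ))) := by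
      intro k hk
      have hk' := (memS k).1 hk
      obtain ⟨r1, r2, r3⟩ := hr k hk'
      have hden := hdens k (hvol k hk') (r k) r1 r2
      have hle : unitBallVol d / 2 * r k ^ d ≤ |a k| := by
        rw [abs_of_neg hk', ← r3]
        exact (ENNReal.ofReal_le_iff_le_toReal (hfin _ (inter_subset_right.trans (hsubA k hk)))).1
          hden.le
      have hrp := vf_rpow hd r1 hle
      rw [← hK]
      have h2 : (2 : ℝ≥0∞) = ENNReal.ofReal 2 := by simp
      rw [h2, ← ENNReal.ofReal_mul (by norm_num), ← ENNReal.ofReal_add (by positivity) (by positivity)]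
      refine ENNReal.ofReal_le_ofReal ?_
      have := mul_le_mul_of_nonneg_left hrp hK0
      rw [← hL] at this
      nlinarith
    refine (Finset.sum_le_sum hk).trans ?_
    rw [← ENNReal.ofReal_sum_of_nonneg (fun k _ => by positivity), ← Finset.mul_sum]
    refine ENNReal.ofReal_le_ofReal ?_
    refine mul_le_mul_of_nonneg_left ?_ (by positivity)
    exact Finset.sum_le_sum_of_subset_of_nonneg (Finset.subset_univ _) fun k _ _ => by positivity
end
end
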